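/- arXiv:math/9803117 — 2 statements merged into one kernel-verified Lean document; each statement's English description precedes it below -/
import Mathlib

section
/- Let 0 < R < ∞ and let (a_k), indexed by multiindices k, be complex numbers with a := sup_k |a_k| R^{‖k‖} k^k/‖k‖^{‖k‖} < ∞. Then for every z ∈ B(R) ⊆ l¹ the family (a_k z^k) is absolutely summable, uniformly on compact subsets of B(R); its sum g(z) defines a holomorphic function g on B(R) whose monomial coefficients are exactly (a_k); and for every compact K ⊆ B(R) there is a constant C_K, depending only on K and R and not on (a_k), such that sup_{z∈K} |g(z)| ≤ C_K · a. -/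
open Set
open scoped ENNReal NNReal

noncomputable section

/-- `l¹`: the space of absolutely summable sequences of complex numbers. -/
abbrev L1 : Type := lp (fun _ : ℕ => ℂ) 1

/-- `ℂ^N` equipped with the `l¹` norm. -/
abbrev EN (N : ℕ) : Type := PiLp 1 (fun _ : Fin N => ℂ)

/-- The `(0,1)`-part of the real Fréchet derivative of `u` at `z`, applied to `ξ`:
`∂̄u(z)(ξ) = (Du(z)(ξ) + i·Du(z)(iξ))/2`. -/
noncomputable def dbar {V : Type*} [NormedAddCommGroup V] [NormedSpace ℂ V]
    (u : V → ℂ) (z ξ : V) : ℂ :=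
  (fderiv ℝ u z ξ + Complex.I * fderiv ℝ u z (Complex.I • ξ)) / 2

/-- `f` is a `(0,1)`-form of class `C^m` on `Ω`: each `f z` is (continuous) conjugate-linear
and `(z,ξ) ↦ f z ξ` is `m` times continuously differentiable in the real sense on `Ω × V`. -/
def IsForm01 {V : Type*} [NormedAddCommGroup V] [NormedSpace ℂ V]
    (m : ℕ) (Ω : Set V) (f : V → V → ℂ) : Prop :=
  (∀ z ∈ Ω, ∀ ξ η : V, f z (ξ + η) = f z ξ + f z η) ∧
  (∀ z ∈ Ω, ∀ (a : ℂ) (ξ : V), f z (a • ξ) = (starRingEnd ℂ) a * f z ξ) ∧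
  ContDiffOn ℝ m (fun p : V × V => f p.1 p.2) (Ω ×ˢ (univ : Set V))

/-- A `(0,1)`-form `f` is `∂̄`-closed on `Ω`. -/
def DbarClosed {V : Type*} [NormedAddCommGroup V] [NormedSpace ℂ V]
    (Ω : Set V) (f : V → V → ℂ) : Prop :=
  ∀ z ∈ Ω, ∀ ξ η : V, dbar (fun w => f w ξ) z η = dbar (fun w => f w η) z ξ

/-- The set of values `‖f z ξ‖`, `z ∈ A`, `‖ξ‖ ≤ 1`; its sup is `|f|_{0,A}`. -/
def formSet0 {V : Type*} [NormedAddCommGroup V]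
    (f : V → V → ℂ) (A : Set V) : Set ℝ :=
  {x | ∃ z ∈ A, ∃ ξ : V, ‖ξ‖ ≤ 1 ∧ x = ‖f z ξ‖}

/-- The set of difference quotients `‖f z ξ - f w ξ‖/‖z-w‖`; its sup is `|f|_{1,A}`. -/
def formSet1 {V : Type*} [NormedAddCommGroup V]
    (f : V → V → ℂ) (A : Set V) : Set ℝ :=
  {x | ∃ z ∈ A, ∃ w ∈ A, z ≠ w ∧ ∃ ξ : V, ‖ξ‖ ≤ 1 ∧ x = ‖f z ξ - f w ξ‖ / ‖z - w‖}

/-- `|f|_{0,A}`. -/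
noncomputable def formNorm0 {V : Type*} [NormedAddCommGroup V]
    (f : V → V → ℂ) (A : Set V) : ℝ := sSup (formSet0 f A)

/-- `|f|_{1,A}`. -/
noncomputable def formNorm1 {V : Type*} [NormedAddCommGroup V]
    (f : V → V → ℂ) (A : Set V) : ℝ := sSup (formSet1 f A)

/-- `f` is Lipschitz continuous on `A`: `|f|_{0,A} < ∞` and `|f|_{1,A} < ∞`. -/
def LipschitzForm {V : Type*} [NormedAddCommGroup V]
    (f : V → V → ℂ) (A : Set V) : Prop :=
  BddAbove (formSet0 f A) ∧ BddAbove (formSet1 f A)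

/-- `‖k‖ = ∑_ν k_ν` for a multiindex `k`. -/
def knormN (k : ℕ →₀ ℕ) : ℕ := k.sum fun _ m => m

/-- `k^k = ∏_ν k_ν^{k_ν}` (with `0^0 = 1`). -/
noncomputable def kk (k : ℕ →₀ ℕ) : ℝ := ∏ ν ∈ k.support, (k ν : ℝ) ^ k ν

/-- `‖k‖^{‖k‖}` (with `0^0 = 1`). -/
noncomputable def nn (k : ℕ →₀ ℕ) : ℝ := ((knormN k : ℝ)) ^ knormN k

/-- The monomial `z^k = ∏_ν z_ν^{k_ν}` (with `0^0 = 1`). -/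
noncomputable def monom (k : ℕ →₀ ℕ) (z : ℕ → ℂ) : ℂ := ∏ ν ∈ k.support, z ν ^ k ν

/-- The term of the series defining `Δ(q,z)` corresponding to the multiindex `k`:
`(‖k‖^{‖k‖}/k^k)·|q|^{#k}·|z^k|`. -/
noncomputable def DeltaTerm (q : ℂ) (z : ℕ → ℂ) (k : ℕ →₀ ℕ) : ℝ :=
  (nn k / kk k) * ‖q‖ ^ k.support.card * ∏ ν ∈ k.support, ‖z ν‖ ^ k ν

/-- `Δ(q,z) = ∑_k (‖k‖^{‖k‖}/k^k)·|q|^{#k}·|z^k|`. -/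
noncomputable def Delta (q : ℂ) (z : ℕ → ℂ) : ℝ := ∑' k, DeltaTerm q z k

open Filter Topology Metric in
lemma diff_aux {E : Type*} [NormedAddCommGroup E] [NormedSpace ℂ E] {ι : Type*} {l : Filter ι}
    [l.NeBot] (f : ι → E → ℂ) (g : E → ℂ) (c : E) (r M : ℝ) (hr : 0 < r)
    (hd : ∀ i, Differentiable ℂ (f i)) (hM : ∀ i, ∀ z ∈ ball c r, ‖f i z‖ ≤ M)
    (hg : ∀ z ∈ ball c r, Tendsto (fun i => f i z) l (𝓝 (g z))) :
    DifferentiableAt ℂ g c := by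
  have hmaps : ∀ i, MapsTo (f i) (ball c r) (closedBall (f i c) (2 * M)) := by
    intro i z hz
    rw [mem_closedBall, dist_eq_norm]
    have h1 := hM i z hz
    have h2 := hM i c (mem_ball_self hr)
    have := norm_sub_le (f i z) (f i c)
    linarith
  have hD : ∀ i, ‖fderiv ℂ (f i) c‖ ≤ 2 * M / r := fun i =>
    Complex.norm_fderiv_le_div_of_mapsTo_ball (hd i).differentiableOn (hmaps i) hr
  have hQ : ∀ i, ∀ z ∈ ball c r, ‖f i z - f i c - fderiv ℂ (f i) c (z - c)‖
      ≤ 4 * M / r ^ 2 * ‖z - c‖ ^ 2 := by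
    intro i z hz
    let F : E → ℂ := fun z => f i z - fderiv ℂ (f i) c (z - c)
    have hFc : F c = f i c := by simp [F]
    have h := Complex.dist_le_mul_div_pow_of_mapsTo_ball_of_isLittleO (f := F) (c := c) (z := z)
      (R₁ := r) (R₂ := 4 * M) (n := 1) ?_ ?_ ?_ hz
    · rw [hFc, dist_eq_norm, dist_eq_norm] at h
      have e : F z - f i c = f i z - f i c - fderiv ℂ (f i) c (z - c) := by simp only [F]; ring
      rw [e] at h
      refine h.trans_eq ?_
      rw [div_pow]; norm_num; ring
    · have : Differentiable ℂ F := by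
        have := hd i
        fun_prop
      exact this.differentiableOn
    · intro w hw
      rw [mem_closedBall, dist_eq_norm, hFc]
      have e : F w - f i c = (f i w - f i c) - fderiv ℂ (f i) c (w - c) := by simp only [F]; ring
      rw [e]
      have h1 := hmaps i hw
      rw [mem_closedBall, dist_eq_norm] at h1
      have h2 : ‖fderiv ℂ (f i) c (w - c)‖ ≤ 2 * M / r * r := by
        refine (ContinuousLinearMap.le_opNorm _ _).trans ?_
        have : ‖w - c‖ ≤ r := by rw [← dist_eq_norm]; exact (mem_ball.1 hw).le
        exact mul_le_mul (hD i) this (norm_nonneg _) ((norm_nonneg _).trans (hD i))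
      rw [div_mul_cancel₀ _ hr.ne'] at h2
      have := norm_sub_le (f i w - f i c) (fderiv ℂ (f i) c (w - c))
      linarith
    · have h := ((hd i) c).hasFDerivAt.isLittleO
      simp only [pow_one, Asymptotics.isLittleO_norm_right]
      refine h.congr_left fun w => ?_
      simp [F]; ring
  let u : Ultrafilter ι := Ultrafilter.of l
  have hu : (u : Filter ι) ≤ l := Ultrafilter.of_le l
  let φ : ι → WeakDual ℂ E := fun i => StrongDual.toWeakDual (fderiv ℂ (f i) c)
  have hc := WeakDual.isCompact_closedBall (𝕜 := ℂ) (E := E) 0 (2 * M / r)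
  obtain ⟨L, -, hL⟩ := hc.ultrafilter_le_nhds (u.map φ) (by
    rw [le_principal_iff]
    refine Filter.mem_map.2 (Filter.univ_mem' fun i => ?_)
    simpa [φ] using hD i)
  have hL' : ∀ v : E, Tendsto (fun i => fderiv ℂ (f i) c v) u (𝓝 (L v)) := by
    intro v
    have h1 : Tendsto φ u (𝓝 L) := hL
    exact ((WeakDual.eval_continuous v).tendsto L).comp h1
  refine HasFDerivAt.differentiableAt (f' := WeakDual.toStrongDual L) ?_
  rw [hasFDerivAt_iff_isLittleO]
  have hO : (fun z => g z - g c - WeakDual.toStrongDual L (z - c)) =O[𝓝 c]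
      fun z => ‖z - c‖ ^ 2 := by
    refine Asymptotics.IsBigO.of_bound (4 * M / r ^ 2) ?_
    filter_upwards [ball_mem_nhds c hr] with z hz
    have ht := (((hg z hz).mono_left hu).sub ((hg c (mem_ball_self hr)).mono_left hu)).sub
      (hL' (z - c))
    have := le_of_tendsto ht.norm (Eventually.of_forall fun i => hQ i z hz)
    simpa using this
  refine hO.trans_isLittleO ?_
  have h2 : (fun z : E => ‖z - c‖ ^ 2) =o[𝓝 c] fun z => ‖z - c‖ ^ 1 := by
    have : Tendsto (fun z : E => z - c) (𝓝 c) (𝓝 0) := by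
      have : Continuous fun z : E => z - c := by fun_prop
      simpa using this.tendsto c
    exact (Asymptotics.isLittleO_norm_pow_norm_pow (E' := E) (show 1 < 2 by norm_num)).comp_tendsto this
  simpa using h2

lemma stirling_aux (δ : ℝ) (hδ : 0 < δ) : ∃ C : ℝ, 1 ≤ C ∧ ∀ k : ℕ,
    (k.factorial : ℝ) * Real.exp 1 ^ k ≤ C * (1 + δ) ^ k * (k : ℝ) ^ k := by
  refine ⟨1 + Real.exp 1 / δ, by have := Real.exp_pos 1; rw [le_add_iff_nonneg_right]; positivity, ?_⟩
  intro k
  have he := Real.exp_pos 1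
  have hpos : 0 ≤ Real.exp 1 / δ := by positivity
  rcases k with _ | n
  · simp; exact hpos
  have h := Stirling.stirlingSeq'_antitone (Nat.zero_le n)
  simp only [Function.comp, Nat.succ_eq_add_one, zero_add, Stirling.stirlingSeq_one] at h
  set k := n + 1 with hk
  have hk0 : (0 : ℝ) < k := by simp [hk]; positivity
  have hk1 : (1 : ℝ) ≤ k := by simp [hk]
  unfold Stirling.stirlingSeq at h
  rw [div_le_iff₀ (by positivity), Real.sqrt_mul (by norm_num), div_pow] at h
  have h2 : √(2:ℝ) ≠ 0 := by positivity
  have h3 : (k.factorial : ℝ) * Real.exp 1 ^ k ≤ Real.exp 1 * √(k:ℝ) * (k:ℝ)^k := by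
    have := mul_le_mul_of_nonneg_right h (show 0 ≤ Real.exp 1 ^ k by positivity)
    refine this.trans_eq ?_
    field_simp
  refine h3.trans ?_
  have h4 : √(k:ℝ) ≤ k := Real.sqrt_le_iff.2 ⟨hk0.le, by nlinarith⟩
  have h5 := one_add_mul_le_pow (a := δ) (by linarith) k
  have h6 : (k:ℝ) ≤ (1 + δ) ^ k / δ := by
    rw [le_div_iff₀ hδ]; linarith
  refine mul_le_mul_of_nonneg_right ?_ (by positivity)
  calc Real.exp 1 * √(k:ℝ) ≤ Real.exp 1 * ((1 + δ) ^ k / δ) :=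
        mul_le_mul_of_nonneg_left (h4.trans h6) he.le
    _ = Real.exp 1 / δ * (1 + δ) ^ k := by ring
    _ ≤ _ := mul_le_mul_of_nonneg_right (by linarith) (by positivity)

open Filter Topology in
lemma multi_hasSum (y : ℕ → ℝ) (s : ℝ) (hy : ∀ i, 0 ≤ y i) (hs : HasSum y s) (h1 : s < 1) :
    HasSum (fun k : ℕ →₀ ℕ => (k.multinomial : ℝ) * ∏ ν ∈ k.support, y ν ^ k ν) (1 - s)⁻¹ := by
  classical
  set t : (ℕ →₀ ℕ) → ℝ := fun k => (k.multinomial : ℝ) * ∏ ν ∈ k.support, y ν ^ k ν with ht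
  have ht0 : ∀ k, 0 ≤ t k := fun k =>
    mul_nonneg (by positivity) (Finset.prod_nonneg fun i _ => pow_nonneg (hy i) _)
  have hlev : ∀ M n : ℕ, ∑ k ∈ Finset.finsuppAntidiag (Finset.range M) n, t k
      = (∑ i ∈ Finset.range M, y i) ^ n := by
    intro M n
    rw [Finset.sum_pow_eq_sum_piAntidiag]
    refine Finset.sum_bij (fun k _ => (k : ℕ → ℕ)) ?_ ?_ ?_ ?_
    · intro k hk
      rw [Finset.mem_finsuppAntidiag] at hk
      rw [Finset.mem_piAntidiag]
      refine ⟨hk.1, fun i hi => hk.2 (Finsupp.mem_support_iff.2 hi)⟩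
    · intro a _ b _ h
      exact DFunLike.coe_injective h
    · intro b hb
      rw [Finset.mem_piAntidiag] at hb
      refine ⟨Finsupp.onFinset (Finset.range M) b hb.2, ?_, rfl⟩
      rw [Finset.mem_finsuppAntidiag]
      exact ⟨hb.1, Finsupp.support_onFinset_subset⟩
    · intro k hk
      rw [Finset.mem_finsuppAntidiag] at hk
      simp only [ht]
      rw [Finsupp.multinomial_eq_of_support_subset hk.2]
      congr 1
      refine Finset.prod_subset hk.2 fun i _ hi => ?_
      rw [Finsupp.notMem_support_iff.1 hi, pow_zero]
  let G : ℕ → Finset (ℕ →₀ ℕ) := fun n =>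
    (Finset.range n).biUnion fun j => Finset.finsuppAntidiag (Finset.range n) j
  have hG : ∀ n, ∑ k ∈ G n, t k
      = ∑ j ∈ Finset.range n, (∑ i ∈ Finset.range n, y i) ^ j := by
    intro n
    rw [Finset.sum_biUnion]
    · exact Finset.sum_congr rfl fun j _ => hlev n j
    · intro a _ b _ hab
      rw [Function.onFun, Finset.disjoint_left]
      intro k hk hk'
      rw [Finset.mem_finsuppAntidiag] at hk hk'
      exact hab (hk.1.symm.trans hk'.1)
  have hmem : ∀ n k, k ∈ G n ↔ (∑ i ∈ Finset.range n, k i < n ∧ k.support ⊆ Finset.range n) := by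
    intro n k
    simp [G]
  have hsumle : ∀ (k : ℕ →₀ ℕ) (s : Finset ℕ), ∑ i ∈ s, k i ≤ ∑ i ∈ k.support, k i := by
    intro k s
    rw [← Finset.sum_filter_ne_zero]
    exact Finset.sum_le_sum_of_subset fun i hi => by
      simpa using (Finset.mem_filter.1 hi).2
  have hGmono : Monotone G := by
    intro m n hmn k hk
    rw [hmem] at hk ⊢
    have hsub : k.support ⊆ Finset.range n := hk.2.trans (Finset.range_mono hmn)
    refine ⟨?_, hsub⟩
    have e1 := Finset.sum_subset hk.2 (f := k) fun i _ hi => Finsupp.notMem_support_iff.1 hi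
    have e2 := hsumle k (Finset.range n)
    omega
  have hGex : ∀ k, ∃ n, k ∈ G n := by
    intro k
    refine ⟨(∑ i ∈ k.support, k i) + k.support.sup id + 1, ?_⟩
    rw [hmem]
    refine ⟨(hsumle _ _).trans_lt (by omega), fun i hi => ?_⟩
    have : i ≤ k.support.sup id := Finset.le_sup (f := id) hi
    rw [Finset.mem_range]; omega
  have hGtop : Tendsto G atTop atTop := tendsto_atTop_finset_of_monotone hGmono hGex
  have hs0 : 0 ≤ s := hs.nonneg hy
  have hle : ∀ n, ∑ i ∈ Finset.range n, y i ≤ s := fun n =>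
    sum_le_hasSum _ (fun i _ => hy i) hs
  have hnn : ∀ n, 0 ≤ ∑ i ∈ Finset.range n, y i := fun n => Finset.sum_nonneg fun i _ => hy i
  have hGle : ∀ n, ∑ k ∈ G n, t k ≤ (1 - s)⁻¹ := by
    intro n
    rw [hG]
    calc _ ≤ ∑ j ∈ Finset.range n, s ^ j :=
          Finset.sum_le_sum fun j _ => pow_le_pow_left₀ (hnn n) (hle n) j
      _ ≤ _ := sum_le_hasSum _ (fun i _ => by positivity) (hasSum_geometric_of_lt_one hs0 h1)
  have hsum : Summable t := by
    refine summable_of_sum_le ht0 (c := (1 - s)⁻¹) fun u => ?_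
    obtain ⟨n, hn⟩ := (hGtop.eventually_ge_atTop u).exists
    exact (Finset.sum_le_sum_of_subset_of_nonneg hn fun i _ _ => ht0 i).trans (hGle n)
  have hl : Tendsto (fun n => ∑ k ∈ G n, t k) atTop (𝓝 (1 - s)⁻¹) := by
    have e : ∀ n, ∑ k ∈ G n, t k = ((1 - (∑ i ∈ Finset.range n, y i) ^ n))
        * (1 - ∑ i ∈ Finset.range n, y i)⁻¹ := by
      intro n
      have hlt : ∑ i ∈ Finset.range n, y i < 1 := (hle n).trans_lt h1
      rw [hG, geom_sum_eq hlt.ne, ← div_eq_mul_inv, ← neg_sub 1, ← neg_sub 1 (∑ i ∈ _, y i),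
        neg_div_neg_eq]
    simp_rw [e]
    have hp : Tendsto (fun n => (∑ i ∈ Finset.range n, y i) ^ n) atTop (𝓝 0) :=
      squeeze_zero (fun n => pow_nonneg (hnn n) n) (fun n => pow_le_pow_left₀ (hnn n) (hle n) n)
        (tendsto_pow_atTop_nhds_zero_of_lt_one hs0 h1)
    have := (hp.const_sub 1).mul ((hs.tendsto_sum_nat.const_sub 1).inv₀ (by linarith))
    simpa using this
  have := tendsto_nhds_unique (hsum.hasSum.comp hGtop) hl
  rw [← this]
  exact hsum.hasSum

lemma kk_pos (k : ℕ →₀ ℕ) : 0 < kk k := by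
  refine Finset.prod_pos fun i hi => ?_
  have : 0 < k i := Nat.pos_of_ne_zero (Finsupp.mem_support_iff.1 hi)
  positivity

lemma nn_pos (k : ℕ →₀ ℕ) : 0 < nn k := by
  unfold nn
  rcases Nat.eq_zero_or_pos (knormN k) with h | h
  · simp [h]
  · positivity

lemma coef_aux (δ C : ℝ) (N : ℕ) (hδ : 0 < δ) (hC : 1 ≤ C)
    (h : ∀ k : ℕ, (k.factorial : ℝ) * Real.exp 1 ^ k ≤ C * (1 + δ) ^ k * (k : ℝ) ^ k)
    (k : ℕ →₀ ℕ) :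
    nn k ≤ kk k * (C ^ N * ((k.multinomial : ℝ) *
      ∏ ν ∈ k.support, (if ν < N then 1 + δ else Real.exp 1) ^ k ν)) := by
  have h1 : nn k ≤ ((knormN k).factorial : ℝ) * Real.exp 1 ^ knormN k := by
    have := Real.pow_div_factorial_le_exp (x := (knormN k : ℝ)) (by positivity) (knormN k)
    rw [div_le_iff₀ (by positivity)] at this
    unfold nn
    rw [← Real.exp_nat_mul, mul_one, mul_comm]
    exact this
  have h2 : ((knormN k).factorial : ℝ) =
      (∏ i ∈ k.support, ((k i).factorial : ℝ)) * (k.multinomial : ℝ) := by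
    have := Nat.multinomial_spec k.support k
    rw [Finsupp.multinomial_eq]
    exact_mod_cast this.symm
  have h3 : Real.exp 1 ^ knormN k = ∏ i ∈ k.support, Real.exp 1 ^ k i := by
    rw [Finset.prod_pow_eq_pow_sum]; rfl
  have h4 : ∏ i ∈ k.support, ((k i).factorial : ℝ) * Real.exp 1 ^ k i ≤
      ∏ i ∈ k.support, (if i < N then C else 1) *
        ((if i < N then 1 + δ else Real.exp 1) ^ k i * (k i : ℝ) ^ k i) := by
    refine Finset.prod_le_prod (fun i _ => by positivity) fun i _ => ?_
    split_ifs with hi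
    · rw [← mul_assoc]; exact h _
    · rw [one_mul, mul_comm]
      refine mul_le_mul_of_nonneg_left ?_ (by positivity)
      exact_mod_cast Nat.factorial_le_pow (k i)
  have h5 : ∏ i ∈ k.support, (if i < N then C else 1) ≤ C ^ N := by
    rw [← Finset.prod_filter, Finset.prod_const]
    refine pow_le_pow_right₀ hC ?_
    have : (k.support.filter (· < N)) ⊆ Finset.range N := fun i hi => by
      simpa using (Finset.mem_filter.1 hi).2
    simpa using Finset.card_le_card this
  have h6 : (0:ℝ) ≤ ∏ i ∈ k.support, (if i < N then 1 + δ else Real.exp 1) ^ k i :=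
    Finset.prod_nonneg fun i _ => by split_ifs <;> positivity
  rw [Finset.prod_mul_distrib, Finset.prod_mul_distrib, Finset.prod_mul_distrib] at h4
  have hk := (kk_pos k).le
  calc nn k ≤ _ := h1
    _ = (k.multinomial : ℝ) * ((∏ i ∈ k.support, ((k i).factorial : ℝ)) *
          ∏ i ∈ k.support, Real.exp 1 ^ k i) := by rw [h2, h3]; ring
    _ ≤ (k.multinomial : ℝ) * (C ^ N *
        ((∏ i ∈ k.support, (if i < N then 1 + δ else Real.exp 1) ^ k i) * kk k)) := by
        refine mul_le_mul_of_nonneg_left (h4.trans ?_) (by positivity)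
        exact mul_le_mul_of_nonneg_right h5 (mul_nonneg h6 hk)
    _ = _ := by ring

lemma l1_hasSum (z : L1) : HasSum (fun i => ‖z i‖) ‖z‖ := by
  simpa using lp.hasSum_norm (p := 1) (by simp) z

lemma eval_cont (i : ℕ) : Continuous fun z : L1 => z i :=
  (lp.evalCLM ℂ (fun _ : ℕ => ℂ) 1 i).continuous

lemma monom_diff (k : ℕ →₀ ℕ) : Differentiable ℂ fun z : L1 => monom k (fun ν => z ν) := by
  unfold monom
  have : ∀ i, Differentiable ℂ fun z : L1 => z i := fun i =>
    (lp.evalCLM ℂ (fun _ : ℕ => ℂ) 1 i).differentiable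
  have h2 : ∀ s : Finset ℕ, Differentiable ℂ fun z : L1 => ∏ ν ∈ s, z ν ^ k ν := by
    intro s
    induction s using Finset.induction_on with
    | empty => simp
    | insert i s hi ih =>
      simp only [Finset.prod_insert hi]
      exact ((this i).fun_pow (k i)).fun_mul ih
  exact h2 k.support

open Filter Topology Metric in
lemma local_aux (R : ℝ) (hR : 0 < R) (z0 : L1) (hz0 : ‖z0‖ < R) :
    ∃ (m : (ℕ →₀ ℕ) → L1 → ℝ) (S : L1 → ℝ) (M r : ℝ), 0 < r ∧ (∀ k, Continuous (m k)) ∧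
      (∀ k z, 0 ≤ m k z) ∧ ContinuousAt S z0 ∧ ∀ z ∈ ball z0 r,
        HasSum (fun k => m k z) (S z) ∧ S z ≤ M ∧
        ∀ k, nn k / (kk k * R ^ knormN k) * ‖monom k (fun ν => z ν)‖ ≤ m k z := by
  have hn0 := norm_nonneg z0
  set δ : ℝ := (R - ‖z0‖) / (2 * R) with hδd
  have hδ : 0 < δ := div_pos (by linarith) (by linarith)
  have hδ1 : δ ≤ 1 := by rw [hδd, div_le_one (by linarith)]; linarith
  have hδz : (1 + δ) * ‖z0‖ < R := by
    have : δ * ‖z0‖ ≤ δ * R := mul_le_mul_of_nonneg_left hz0.le hδ.le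
    have h2 : δ * R = (R - ‖z0‖) / 2 := by rw [hδd]; field_simp
    linarith
  obtain ⟨C, hC, hst⟩ := stirling_aux δ hδ
  have he0 := Real.exp_pos 1
  have he3 : Real.exp 1 ≤ 3 := Real.exp_one_lt_three.le
  obtain ⟨N, hN⟩ : ∃ N, (1 + δ) * ‖z0‖ + Real.exp 1 * (‖z0‖ - ∑ i ∈ Finset.range N, ‖z0 i‖) < R := by
    have h := (((l1_hasSum z0).tendsto_sum_nat.const_sub ‖z0‖).const_mul (Real.exp 1)).const_add
      ((1 + δ) * ‖z0‖)
    simp only [sub_self, mul_zero, add_zero] at h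
    exact (h.eventually_lt_const hδz).exists
  set c : ℕ → ℝ := fun ν => if ν < N then 1 + δ else Real.exp 1 with hc
  have hc0 : ∀ i, 0 ≤ c i := fun i => by simp only [hc]; split_ifs <;> positivity
  have hc3 : ∀ i, c i ≤ 3 := fun i => by simp only [hc]; split_ifs <;> linarith
  let y : L1 → ℕ → ℝ := fun z i => c i * ‖z i‖ / R
  have hy0 : ∀ z i, 0 ≤ y z i := fun z i =>
    div_nonneg (mul_nonneg (hc0 i) (norm_nonneg _)) hR.le
  have hyle : ∀ z i, y z i ≤ 3 / R * ‖z i‖ := fun z i => by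
    rw [div_mul_eq_mul_div]
    exact div_le_div_of_nonneg_right (mul_le_mul_of_nonneg_right (hc3 i) (norm_nonneg _)) hR.le
  have hys : ∀ z, Summable (y z) := fun z =>
    Summable.of_nonneg_of_le (hy0 z) (hyle z) ((l1_hasSum z).summable.mul_left _)
  let Y : L1 → ℝ := fun z => ∑' i, y z i
  have hYs : ∀ z, HasSum (y z) (Y z) := fun z => (hys z).hasSum
  have hYc : Continuous Y := by
    refine (LipschitzWith.of_le_add_mul (Real.toNNReal (3 / R)) fun z w => ?_).continuous
    rw [Real.coe_toNNReal _ (by positivity), dist_eq_norm]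
    refine hasSum_le (fun i => ?_) (hYs z) ((hYs w).add ((l1_hasSum (z - w)).mul_left (3 / R)))
    have h1 : y z i ≤ y w i + y (z - w) i := by
      simp only [y]
      rw [← add_div, ← mul_add]
      refine div_le_div_of_nonneg_right (mul_le_mul_of_nonneg_left ?_ (hc0 i)) hR.le
      have : z i = w i + (z - w) i := by simp
      rw [this]
      exact norm_add_le _ _
    exact h1.trans (by linarith [hyle (z - w) i])
  have hY0 : Y z0 < 1 := by
    have hh : HasSum (fun i => if i < N then ‖z0 i‖ else 0) (∑ i ∈ Finset.range N, ‖z0 i‖) := by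
      have := hasSum_sum_of_ne_finset_zero (L := SummationFilter.unconditional ℕ) (s := Finset.range N)
        (f := fun i => if i < N then ‖z0 i‖ else 0) (fun i hi => by
          rw [Finset.mem_range] at hi; simp [hi])
      convert this using 1
      exact Finset.sum_congr rfl fun i hi => by rw [Finset.mem_range] at hi; simp [hi]
    have h2 := ((l1_hasSum z0).mul_left (1 + δ)).add
      (((l1_hasSum z0).sub hh).mul_left (Real.exp 1))
    refine lt_of_le_of_lt (hasSum_le (fun i => ?_) (hYs z0) (h2.div_const R)) ?_
    rotate_left
    · rwa [div_lt_one hR]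
    · refine div_le_div_of_nonneg_right ?_ hR.le
      have := norm_nonneg (z0 i)
      simp only [hc]
      split_ifs
      · simp
      · rw [sub_zero]
        have : 0 ≤ (1 + δ) * ‖z0 i‖ := by positivity
        linarith
  obtain ⟨ρ, hρ0, hρ1⟩ := exists_between hY0
  obtain ⟨r, hr, hball⟩ := Metric.eventually_nhds_iff_ball.1
    (hYc.continuousAt.eventually_lt_const hρ0)
  have hCN : 0 ≤ C ^ N := by positivity
  refine ⟨fun k z => C ^ N * ((k.multinomial : ℝ) * ∏ ν ∈ k.support, y z ν ^ k ν),
    fun z => C ^ N * (1 - Y z)⁻¹, C ^ N * (1 - ρ)⁻¹, r, hr, ?_, ?_, ?_, ?_⟩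
  · intro k
    have : ∀ i, Continuous fun z : L1 => y z i := fun i => by
      exact ((eval_cont i).norm.const_mul (c i)).div_const R
    exact (continuous_finsetProd _ fun i _ => (this i).pow (k i)).const_mul _ |>.const_mul _
  · intro k z
    exact mul_nonneg hCN (mul_nonneg (by positivity)
      (Finset.prod_nonneg fun i _ => pow_nonneg (hy0 z i) _))
  · have h9 : ContinuousAt (fun z => 1 - Y z) z0 := (continuous_const.sub hYc).continuousAt
    exact continuousAt_const.mul (h9.inv₀ (by linarith))
  · intro z hz
    have hYz := hball z hz
    refine ⟨(multi_hasSum (y z) (Y z) (hy0 z) (hYs z) (hYz.trans hρ1)).mul_left _, ?_, ?_⟩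
    · refine mul_le_mul_of_nonneg_left ?_ hCN
      exact inv_anti₀ (by linarith) (by linarith)
    · intro k
      have h1 := coef_aux δ C N hδ hC hst k
      have h2 : ∏ ν ∈ k.support, y z ν ^ k ν =
          (∏ ν ∈ k.support, c ν ^ k ν) * ‖monom k (fun ν => z ν)‖ / R ^ knormN k := by
        have : R ^ knormN k = ∏ i ∈ k.support, R ^ k i := by
          rw [Finset.prod_pow_eq_pow_sum]; rfl
        rw [this, monom, norm_prod, ← Finset.prod_mul_distrib, ← Finset.prod_div_distrib]
        refine Finset.prod_congr rfl fun i _ => ?_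
        simp only [y, norm_pow, mul_pow, div_pow]
      have hk := kk_pos k
      beta_reduce
      rw [h2, ← div_div, div_mul_eq_mul_div, ← mul_div_assoc, ← mul_div_assoc]
      refine div_le_div_of_nonneg_right ?_ (by positivity)
      rw [← mul_assoc, ← mul_assoc]
      refine mul_le_mul_of_nonneg_right ?_ (norm_nonneg _)
      rw [div_le_iff₀ hk]
      refine h1.trans_eq ?_
      simp only [hc]
      ring

lemma term_aux (R : ℝ) (hR : 0 < R) (a : (ℕ →₀ ℕ) → ℂ) (A : ℝ)
    (hA : ∀ k : ℕ →₀ ℕ, ‖a k‖ * R ^ knormN k * kk k / nn k ≤ A) (k : ℕ →₀ ℕ) (z : ℕ → ℂ) (m : ℝ)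
    (hm : nn k / (kk k * R ^ knormN k) * ‖monom k z‖ ≤ m) : 0 ≤ A ∧ ‖a k * monom k z‖ ≤ A * m := by
  have hk := kk_pos k
  have hn := nn_pos k
  have hA0 : 0 ≤ A := le_trans (by positivity) (hA k)
  refine ⟨hA0, ?_⟩
  have h1 : ‖a k‖ ≤ A * (nn k / (kk k * R ^ knormN k)) := by
    have h := hA k
    rw [div_le_iff₀ hn] at h
    rw [← mul_div_assoc, le_div_iff₀ (by positivity)]
    linarith
  rw [norm_mul]
  calc _ ≤ A * (nn k / (kk k * R ^ knormN k)) * ‖monom k z‖ :=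
        mul_le_mul_of_nonneg_right h1 (norm_nonneg _)
    _ = A * (nn k / (kk k * R ^ knormN k) * ‖monom k z‖) := by ring
    _ ≤ _ := mul_le_mul_of_nonneg_left hm hA0

/-- Let `0 < R < ∞` and let `(a_k)` satisfy
`a := sup_k |a_k| R^{‖k‖} k^k/‖k‖^{‖k‖} < ∞`. Then for every `z ∈ B(R) ⊆ l¹` the family
`(a_k z^k)` is absolutely summable, uniformly on compact subsets of `B(R)`; its sum `g` is
holomorphic on `B(R)` with monomial coefficients `(a_k)`; and for every compact `K ⊆ B(R)`
there is `C_K` (depending only on `K` and `R`, not on `(a_k)`) with `sup_K |g| ≤ C_K·a`. -/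
theorem statement7 (R : ℝ) (hR : 0 < R) :
    (∀ a : (ℕ →₀ ℕ) → ℂ,
      BddAbove (Set.range fun k : ℕ →₀ ℕ => ‖a k‖ * R ^ knormN k * kk k / nn k) →
      (∀ z : L1, ‖z‖ < R → Summable fun k => ‖a k * monom k (fun ν => z ν)‖) ∧
      (∀ K ⊆ {z : L1 | ‖z‖ < R}, IsCompact K → ∀ ε > (0 : ℝ),
        ∃ F : Finset (ℕ →₀ ℕ), ∀ z ∈ K,
          ∑' k : {k : ℕ →₀ ℕ // k ∉ F}, ‖a k.1 * monom k.1 (fun ν => z ν)‖ < ε) ∧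
      DifferentiableOn ℂ (fun z : L1 => ∑' k, a k * monom k (fun ν => z ν))
        {z : L1 | ‖z‖ < R} ∧
      (∀ z : L1, ‖z‖ < R →
        HasSum (fun k => a k * monom k (fun ν => z ν))
          (∑' k, a k * monom k (fun ν => z ν)))) ∧
    ∀ K ⊆ {z : L1 | ‖z‖ < R}, IsCompact K → ∃ C : ℝ,
      ∀ (a : (ℕ →₀ ℕ) → ℂ) (A : ℝ),
        (∀ k : ℕ →₀ ℕ, ‖a k‖ * R ^ knormN k * kk k / nn k ≤ A) →
        ∀ z ∈ K, ‖∑' k, a k * monom k (fun ν => z ν)‖ ≤ C * A := by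
  constructor
  · intro a hbdd
    obtain ⟨A, hA'⟩ := hbdd
    have hA : ∀ k : ℕ →₀ ℕ, ‖a k‖ * R ^ knormN k * kk k / nn k ≤ A := fun k => hA' ⟨k, rfl⟩
    have hsum : ∀ z : L1, ‖z‖ < R → Summable fun k => ‖a k * monom k (fun ν => z ν)‖ := by
      intro z hz
      obtain ⟨m, S, M, r, hr, -, -, -, h⟩ := local_aux R hR z hz
      obtain ⟨h1, -, h3⟩ := h z (Metric.mem_ball_self hr)
      exact Summable.of_nonneg_of_le (fun _ => norm_nonneg _)
        (fun k => (term_aux R hR a A hA k _ _ (h3 k)).2) (h1.summable.mul_left A)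
    refine ⟨hsum, ?_, ?_, fun z hz => (hsum z hz).of_norm.hasSum⟩
    · intro K hK hKc ε hε
      suffices hp : ∃ F : Finset (ℕ →₀ ℕ), ∀ z ∈ K,
          (Summable fun k => ‖a k * monom k (fun ν => z ν)‖) ∧
          ∑' k : {k : ℕ →₀ ℕ // k ∉ F}, ‖a k.1 * monom k.1 (fun ν => z ν)‖ < ε by
        obtain ⟨F, hF⟩ := hp
        exact ⟨F, fun z hz => (hF z hz).2⟩
      refine hKc.induction_on (p := fun s => ∃ F : Finset (ℕ →₀ ℕ), ∀ z ∈ s,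
          (Summable fun k => ‖a k * monom k (fun ν => z ν)‖) ∧
          ∑' k : {k : ℕ →₀ ℕ // k ∉ F}, ‖a k.1 * monom k.1 (fun ν => z ν)‖ < ε) ?_ ?_ ?_ ?_
      · exact ⟨∅, fun z hz => absurd hz (Set.notMem_empty z)⟩
      · rintro s t hst ⟨F, hF⟩
        exact ⟨F, fun z hz => hF z (hst hz)⟩
      · classical
        rintro s t ⟨F, hF⟩ ⟨G, hG⟩
        have key : ∀ (F G : Finset (ℕ →₀ ℕ)) (z : L1), F ⊆ G →
            (Summable fun k => ‖a k * monom k (fun ν => z ν)‖) →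
            ∑' k : {k : ℕ →₀ ℕ // k ∉ G}, ‖a k.1 * monom k.1 (fun ν => z ν)‖ ≤
            ∑' k : {k : ℕ →₀ ℕ // k ∉ F}, ‖a k.1 * monom k.1 (fun ν => z ν)‖ := by
          intro F G z hFG hs
          have e1 := hs.sum_add_tsum_subtype_compl F
          have e2 := hs.sum_add_tsum_subtype_compl G
          have e3 := Finset.sum_le_sum_of_subset_of_nonneg hFG
            (f := fun k => ‖a k * monom k (fun ν => z ν)‖) fun i _ _ => norm_nonneg _
          linarith
        refine ⟨F ∪ G, fun z hz => ?_⟩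
        rcases hz with hz | hz
        · exact ⟨(hF z hz).1, (key _ _ z Finset.subset_union_left (hF z hz).1).trans_lt (hF z hz).2⟩
        · exact ⟨(hG z hz).1, (key _ _ z Finset.subset_union_right (hG z hz).1).trans_lt (hG z hz).2⟩
      · intro x hx
        obtain ⟨m, S, M, r, hr, hmc, hm0, hS, h⟩ := local_aux R hR x (hK hx)
        have hA0 : 0 ≤ A := (term_aux R hR a A hA 0 (fun ν => x ν) _ le_rfl).1
        have hx' := (h x (Metric.mem_ball_self hr)).1
        have hlim : Filter.Tendsto (fun F : Finset (ℕ →₀ ℕ) => A * (S x - ∑ k ∈ F, m k x))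
            Filter.atTop (nhds 0) := by
          have := (Filter.Tendsto.const_sub (S x) hx').const_mul A
          simpa using this
        obtain ⟨F, hF⟩ := (hlim.eventually_lt_const hε).exists
        have hcont : ContinuousAt (fun z => A * (S z - ∑ k ∈ F, m k z)) x := by
          refine continuousAt_const.mul (hS.sub ?_)
          exact (continuous_finsetSum F fun k _ => hmc k).continuousAt
        refine ⟨_, mem_nhdsWithin_of_mem_nhds (Filter.inter_mem
          (hcont.eventually_lt_const hF) (Metric.ball_mem_nhds x hr)), F, ?_⟩
        rintro z ⟨hz1, hz2⟩
        obtain ⟨h1, -, h3⟩ := h z hz2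
        have ht : ∀ k, ‖a k * monom k (fun ν => z ν)‖ ≤ A * m k z :=
          fun k => (term_aux R hR a A hA k _ _ (h3 k)).2
        have hs : Summable fun k => ‖a k * monom k (fun ν => z ν)‖ :=
          Summable.of_nonneg_of_le (fun _ => norm_nonneg _) ht (h1.summable.mul_left A)
        refine ⟨hs, lt_of_le_of_lt ?_ hz1⟩
        have hAm := h1.mul_left A
        have e := hAm.summable.sum_add_tsum_subtype_compl F
        rw [hAm.tsum_eq, ← Finset.mul_sum] at e
        have e2 : A * (S z - ∑ k ∈ F, m k z) = ∑' k : {k : ℕ →₀ ℕ // k ∉ F}, A * m k.1 z := by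
          rw [mul_sub]; linarith
        rw [e2]
        exact Summable.tsum_le_tsum (fun k => ht k.1)
          (hs.comp_injective Subtype.val_injective)
          (hAm.summable.comp_injective Subtype.val_injective)
    · intro x hx
      obtain ⟨m, S, M, r, hr, hmc, hm0, hS, h⟩ := local_aux R hR x hx
      have hA0 : 0 ≤ A := (term_aux R hR a A hA 0 (fun ν => x ν) _ le_rfl).1
      refine DifferentiableAt.differentiableWithinAt ?_
      refine diff_aux (l := (Filter.atTop : Filter (Finset (ℕ →₀ ℕ))))
        (fun F z => ∑ k ∈ F, a k * monom k (fun ν => z ν)) _ x r (A * M) hr ?_ ?_ ?_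
      · intro F
        have := monom_diff
        fun_prop
      · intro F z hz
        obtain ⟨h1, h2, h3⟩ := h z hz
        calc _ ≤ ∑ k ∈ F, ‖a k * monom k (fun ν => z ν)‖ := norm_sum_le _ _
          _ ≤ ∑ k ∈ F, A * m k z :=
            Finset.sum_le_sum fun k _ => (term_aux R hR a A hA k _ _ (h3 k)).2
          _ ≤ A * S z := sum_le_hasSum _ (fun k _ => mul_nonneg hA0 (hm0 k z)) (h1.mul_left A)
          _ ≤ _ := mul_le_mul_of_nonneg_left h2 hA0
      · intro z hz
        obtain ⟨h1, h2, h3⟩ := h z hz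
        have : Summable fun k => a k * monom k (fun ν => z ν) :=
          Summable.of_norm_bounded (h1.summable.mul_left A)
            fun k => (term_aux R hR a A hA k _ _ (h3 k)).2
        exact this.hasSum
  · intro K hK hKc
    refine hKc.induction_on (p := fun s => ∃ C : ℝ,
      ∀ (a : (ℕ →₀ ℕ) → ℂ) (A : ℝ),
        (∀ k : ℕ →₀ ℕ, ‖a k‖ * R ^ knormN k * kk k / nn k ≤ A) →
        ∀ z ∈ s, ‖∑' k, a k * monom k (fun ν => z ν)‖ ≤ C * A) ?_ ?_ ?_ ?_
    · exact ⟨0, fun _ _ _ z hz => absurd hz (Set.notMem_empty z)⟩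
    · rintro s t hst ⟨C, hC⟩
      exact ⟨C, fun a A hA z hz => hC a A hA z (hst hz)⟩
    · rintro s t ⟨C, hC⟩ ⟨D, hD⟩
      refine ⟨max C D, fun a A hA z hz => ?_⟩
      have hA0 : 0 ≤ A := (term_aux R hR a A hA 0 (fun ν => z ν) _ le_rfl).1
      rcases hz with hz | hz
      · exact (hC a A hA z hz).trans (mul_le_mul_of_nonneg_right (le_max_left _ _) hA0)
      · exact (hD a A hA z hz).trans (mul_le_mul_of_nonneg_right (le_max_right _ _) hA0)
    · intro x hx
      obtain ⟨m, S, M, r, hr, hmc, hm0, hS, h⟩ := local_aux R hR x (hK hx)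
      refine ⟨_, mem_nhdsWithin_of_mem_nhds (Metric.ball_mem_nhds x hr), M, ?_⟩
      intro a A hA z hz
      obtain ⟨h1, h2, h3⟩ := h z hz
      have hA0 : 0 ≤ A := (term_aux R hR a A hA 0 (fun ν => z ν) _ le_rfl).1
      calc _ ≤ A * S z := tsum_of_norm_bounded (h1.mul_left A)
            fun k => (term_aux R hR a A hA k _ _ (h3 k)).2
        _ ≤ A * M := mul_le_mul_of_nonneg_left h2 hA0
        _ = _ := mul_comm _ _
end
end

section
/- Let 0 < R ≤ ∞ and let h be a holomorphic function on the ball B(R) ⊆ l¹, with monomial coefficients (a_k). Then for every z ∈ B(R) the family (a_k z^k) is absolutely summable with sum h(z), the convergence being uniform and absolute on compact subsets of B(R); moreover, for every sequence σ = (σ_ν) of reals with 0 ≤ σ_ν < R and σ_ν → 0, the quantities |a_k| σ^k k^k/‖k‖^{‖k‖} tend to 0 along the cofinite filter on the set of multiindices (i.e., for every ε > 0 only finitely many multiindices k satisfy |a_k| σ^k k^k/‖k‖^{‖k‖} ≥ ε). -/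
open Set
open scoped ENNReal NNReal

noncomputable section

lemma fact_bound (c : ℝ) (hc : 1 < c) : ∃ C : ℝ, 1 ≤ C ∧ ∀ m : ℕ,
    Real.exp 1 ^ m * (m.factorial : ℝ) ≤ C * c ^ m * (m : ℝ) ^ m := by
  have hs1 : 0 < Stirling.stirlingSeq 1 := by
    simpa using Stirling.stirlingSeq'_pos 0
  refine ⟨max 1 (2 * Stirling.stirlingSeq 1 / (c - 1)), le_max_left _ _, fun m => ?_⟩
  rcases Nat.eq_zero_or_pos m with rfl | hm
  · simp
  have h1 : Stirling.stirlingSeq m ≤ Stirling.stirlingSeq 1 := by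
    have := Stirling.stirlingSeq'_antitone (Nat.zero_le (m - 1))
    simpa [Nat.sub_add_cancel hm] using this
  have hmR : (1 : ℝ) ≤ m := by exact_mod_cast hm
  have hsq : 0 < √(2 * m : ℝ) := Real.sqrt_pos.2 (by positivity)
  have hp : 0 < ((m : ℝ) / Real.exp 1) ^ m := by positivity
  rw [Stirling.stirlingSeq, div_le_iff₀ (by positivity)] at h1
  have h2 : √(2 * m : ℝ) ≤ 2 * m := by
    rw [Real.sqrt_le_left (by positivity)]
    nlinarith
  have h3 : (m : ℝ) * (c - 1) ≤ c ^ m := by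
    have := one_add_mul_le_pow (a := c - 1) (by linarith) m
    have h4 : (1 + (c - 1)) = c := by ring
    rw [h4] at this
    linarith
  have h5 : Real.exp 1 ^ m * ((m : ℝ) / Real.exp 1) ^ m = (m : ℝ) ^ m := by
    rw [← mul_pow]; congr 1; field_simp
  have hc' : 0 < c - 1 := by linarith
  calc Real.exp 1 ^ m * (m.factorial : ℝ)
      ≤ Real.exp 1 ^ m * (Stirling.stirlingSeq 1 * (√(2 * m : ℝ) * ((m : ℝ) / Real.exp 1) ^ m)) := by
        gcongr
    _ = Stirling.stirlingSeq 1 * √(2 * m : ℝ) * (Real.exp 1 ^ m * ((m : ℝ) / Real.exp 1) ^ m) := by ring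
    _ = Stirling.stirlingSeq 1 * √(2 * m : ℝ) * (m : ℝ) ^ m := by rw [h5]
    _ ≤ Stirling.stirlingSeq 1 * (2 * m) * (m : ℝ) ^ m := by gcongr
    _ = (2 * Stirling.stirlingSeq 1 / (c - 1)) * (m * (c - 1)) * (m : ℝ) ^ m := by
        field_simp
    _ ≤ (2 * Stirling.stirlingSeq 1 / (c - 1)) * c ^ m * (m : ℝ) ^ m := by gcongr
    _ ≤ _ := by gcongr; exact le_max_right _ _

lemma kk_eq (k : ℕ →₀ ℕ) (S : Finset ℕ) (hS : k.support ⊆ S) :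
    kk k = ∏ i ∈ S, (k i : ℝ) ^ k i := by
  unfold kk
  refine Finset.prod_subset hS fun i _ hi => ?_
  simp [Finsupp.notMem_support_iff.1 hi]

lemma knormN_eq (k : ℕ →₀ ℕ) (S : Finset ℕ) (hS : k.support ⊆ S) :
    knormN k = ∑ i ∈ S, k i := by
  unfold knormN
  exact Finsupp.sum_of_support_subset _ hS _ (by simp)

lemma prodpow_eq {M : Type*} [CommMonoid M] (k : ℕ →₀ ℕ) (w : ℕ → M) (S : Finset ℕ)
    (hS : k.support ⊆ S) :
    ∏ i ∈ k.support, w i ^ k i = ∏ i ∈ S, w i ^ k i := by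
  refine Finset.prod_subset hS fun i _ hi => ?_
  simp [Finsupp.notMem_support_iff.1 hi]

lemma term_bound (c C : ℝ) (hC1 : 1 ≤ C) (hc : 1 < c) (N : ℕ)
    (hC : ∀ m : ℕ, Real.exp 1 ^ m * (m.factorial : ℝ) ≤ C * c ^ m * (m : ℝ) ^ m)
    (w : ℕ → ℝ) (hw : ∀ i, 0 ≤ w i) (k : ℕ →₀ ℕ) (S : Finset ℕ) (hS : k.support ⊆ S) :
    nn k / kk k * ∏ i ∈ k.support, w i ^ k i ≤
      C ^ N * (Nat.multinomial S k *
        ∏ i ∈ S, ((if i < N then c else Real.exp 1) * w i) ^ k i) := by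
  have hkk := kk_pos k
  have h1 : nn k ≤ Real.exp 1 ^ (knormN k) * (knormN k).factorial := by
    have := Real.pow_div_factorial_le_exp (x := (knormN k : ℝ)) (by positivity) (knormN k)
    rw [div_le_iff₀ (by positivity)] at this
    rw [← Real.exp_nat_mul, mul_one]
    exact this
  have h2 : Real.exp 1 ^ (knormN k) * ((knormN k).factorial : ℝ) =
      Nat.multinomial S k * ∏ i ∈ S, (Real.exp 1 ^ k i * ((k i).factorial : ℝ)) := by
    rw [knormN_eq k S hS, ← Nat.multinomial_spec, Finset.prod_mul_distrib,
      Finset.prod_pow_eq_pow_sum]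
    push_cast
    ring
  have h3 : ∏ i ∈ S, (Real.exp 1 ^ k i * ((k i).factorial : ℝ)) ≤
      ∏ i ∈ S, ((if i < N then C else 1) * ((if i < N then c else Real.exp 1) ^ k i
        * (k i : ℝ) ^ k i)) := by
    refine Finset.prod_le_prod (fun i _ => by positivity) fun i _ => ?_
    split_ifs with hi
    · linarith [hC (k i)]
    · rw [one_mul]
      gcongr
      exact_mod_cast Nat.factorial_le_pow (k i)
  have h4 : ∏ i ∈ S, (if i < N then C else 1) ≤ C ^ N := by
    rw [← Finset.prod_filter, Finset.prod_const]
    refine pow_le_pow_right₀ hC1 ?_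
    calc _ ≤ (Finset.range N).card := Finset.card_le_card (by intro i; simp)
      _ = N := by simp
  have hce : ∀ i : ℕ, 0 ≤ (if i < N then c else Real.exp 1) := by
    intro i; split_ifs <;> positivity
  have h5 : nn k ≤ C ^ N * (Nat.multinomial S k *
        ∏ i ∈ S, (if i < N then c else Real.exp 1) ^ k i) * kk k := by
    rw [kk_eq k S hS]
    calc nn k ≤ _ := h1
      _ = _ := h2
      _ ≤ _ := mul_le_mul_of_nonneg_left h3 (by positivity)
      _ = (∏ i ∈ S, (if i < N then C else 1)) * (Nat.multinomial S k *
        ∏ i ∈ S, (if i < N then c else Real.exp 1) ^ k i) * ∏ i ∈ S, (k i : ℝ) ^ k i := by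
        rw [Finset.prod_mul_distrib, Finset.prod_mul_distrib]; ring
      _ ≤ _ := by
        have : 0 ≤ ∏ i ∈ S, (if i < N then c else Real.exp 1) ^ k i :=
          Finset.prod_nonneg fun i _ => pow_nonneg (hce i) _
        gcongr
  rw [prodpow_eq k w S hS]
  simp only [mul_pow]
  rw [Finset.prod_mul_distrib, ← mul_assoc, ← mul_assoc]
  refine mul_le_mul_of_nonneg_right ?_ (Finset.prod_nonneg fun i _ => pow_nonneg (hw i) _)
  rw [div_le_iff₀ hkk]
  linarith [h5]

lemma delta_bound (c : ℝ) (hc : 1 < c) (N : ℕ) (θ : ℝ) (hθ : θ < 1) :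
    ∃ C : ℝ, 0 ≤ C ∧ ∀ w : ℕ → ℝ, (∀ i, 0 ≤ w i) →
      (∀ T : Finset ℕ, ∑ i ∈ T, (if i < N then c else Real.exp 1) * w i ≤ θ) →
      ∀ F : Finset (ℕ →₀ ℕ),
        ∑ k ∈ F, nn k / kk k * ∏ i ∈ k.support, w i ^ k i ≤ C := by
  obtain ⟨C, hC1, hC⟩ := fact_bound c hc
  refine ⟨C ^ N * (1 - θ)⁻¹, ?_, fun w hw hT F => ?_⟩
  · have : 0 < 1 - θ := by linarith
    positivity
  classical
  have hθ0 : 0 ≤ θ := by simpa using hT ∅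
  set W : ℕ → ℝ := fun i => (if i < N then c else Real.exp 1) * w i with hW
  have hW0 : ∀ i, 0 ≤ W i := by
    intro i; simp only [hW]; split_ifs <;> exact mul_nonneg (by positivity) (hw i)
  set S : Finset ℕ := F.biUnion Finsupp.support with hSdef
  have hS : ∀ k ∈ F, k.support ⊆ S := fun k hk => Finset.subset_biUnion_of_mem Finsupp.support hk
  have h0 : 0 ≤ C ^ N := by positivity
  calc ∑ k ∈ F, nn k / kk k * ∏ i ∈ k.support, w i ^ k i
      ≤ ∑ k ∈ F, C ^ N * (Nat.multinomial S k * ∏ i ∈ S, W i ^ k i) :=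
        Finset.sum_le_sum fun k hk => term_bound c C hC1 hc N hC w hw k S (hS k hk)
    _ = C ^ N * ∑ k ∈ F, (Nat.multinomial S k * ∏ i ∈ S, W i ^ k i) := by rw [Finset.mul_sum]
    _ ≤ C ^ N * (1 - θ)⁻¹ := by
        refine mul_le_mul_of_nonneg_left ?_ h0
        rw [← Finset.sum_fiberwise_of_maps_to (t := F.image knormN) (g := knormN)
          (fun k hk => Finset.mem_image_of_mem _ hk)]
        calc _ ≤ ∑ n ∈ F.image knormN, θ ^ n := by
              refine Finset.sum_le_sum fun n _ => ?_
              calc _ ≤ (∑ i ∈ S, W i) ^ n := ?_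
                _ ≤ θ ^ n := pow_le_pow_left₀ (Finset.sum_nonneg fun i _ => hW0 i) (hT S) n
              rw [Finset.sum_pow_eq_sum_piAntidiag]
              rw [← Finset.sum_image (s := F.filter (fun k => knormN k = n))
                (g := fun k : ℕ →₀ ℕ => (k : ℕ → ℕ))
                (f := fun k : ℕ → ℕ => (Nat.multinomial S k : ℝ) * ∏ i ∈ S, W i ^ k i)
                (fun a _ b _ hab => DFunLike.coe_injective hab)]
              refine Finset.sum_le_sum_of_subset_of_nonneg ?_ fun k _ _ =>
                mul_nonneg (by positivity) (Finset.prod_nonneg fun i _ => pow_nonneg (hW0 i) _)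
              intro f hf
              obtain ⟨k, hk, rfl⟩ := Finset.mem_image.1 hf
              obtain ⟨hkF, hkn⟩ := Finset.mem_filter.1 hk
              rw [Finset.mem_piAntidiag]
              refine ⟨by rw [← hkn, knormN_eq k S (hS k hkF)], fun i hi => hS k hkF ?_⟩
              simpa using hi
          _ ≤ ∑' n : ℕ, θ ^ n := (summable_geometric_of_lt_one hθ0 hθ).sum_le_tsum _
              (fun n _ => pow_nonneg hθ0 n)
          _ = (1 - θ)⁻¹ := tsum_geometric_of_lt_one hθ0 hθ

open MeasureTheory in
lemma integral_fourier_haar (n : ℤ) (hn : n ≠ 0) :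
    ∫ x : AddCircle (1 : ℝ), fourier n x ∂AddCircle.haarAddCircle = 0 :=
  integral_eq_zero_of_add_right_eq_neg (fourier_add_half_inv_index hn Real.zero_lt_one)

open MeasureTheory in
lemma torus_coeff (S : Finset ℕ) (f : (ℕ →₀ ℕ) → ℂ) (hf : Summable fun m => ‖f m‖)
    (hfS : ∀ m, f m ≠ 0 → m.support ⊆ S) (M : ℝ)
    (hM : ∀ u : ℕ → ℂ, (∀ i, ‖u i‖ = 1) → ‖∑' m, f m * monom m u‖ ≤ M)
    (k : ℕ →₀ ℕ) (hk : k.support ⊆ S) : ‖f k‖ ≤ M := by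
  classical
  let μ : Measure (S → AddCircle (1 : ℝ)) := Measure.pi fun _ => AddCircle.haarAddCircle
  let G : (ℕ →₀ ℕ) → (S → AddCircle (1 : ℝ)) → ℂ := fun m θ =>
    f m * ∏ i : S, fourier ((m i : ℤ) - (k i : ℤ)) (θ i)
  have hGn : ∀ m θ, ‖G m θ‖ = ‖f m‖ := by
    intro m θ
    simp only [G, norm_mul, norm_prod, fourier_apply, Circle.norm_coe, Finset.prod_const_one,
      mul_one]
  have hGc : ∀ m, Continuous (G m) := by
    intro m
    simp only [G]
    fun_prop
  have hGi : ∀ m, Integrable (G m) μ := by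
    intro m
    refine Integrable.of_bound (hGc m).aestronglyMeasurable ‖f m‖ ?_
    exact Filter.Eventually.of_forall fun θ => (hGn m θ).le
  have hint : ∀ m, ∫ θ, G m θ ∂μ = f m * ∏ i : S,
      ∫ x : AddCircle (1 : ℝ), fourier ((m i : ℤ) - (k i : ℤ)) x ∂AddCircle.haarAddCircle := by
    intro m
    simp only [G]
    rw [integral_const_mul]
    congr 1
    exact integral_fintype_prod_eq_prod (𝕜 := ℂ)
      (fun (i : S) (x : AddCircle (1 : ℝ)) => fourier ((m i : ℤ) - (k i : ℤ)) x)
  have h0 : ∀ m, m ≠ k → ∫ θ, G m θ ∂μ = 0 := by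
    intro m hm
    rw [hint]
    by_cases hfm : f m = 0
    · simp [hfm]
    obtain ⟨i, hi⟩ : ∃ i, m i ≠ k i := by
      by_contra! hcon
      exact hm (Finsupp.ext hcon)
    have hiS : i ∈ S := by
      by_contra hiS
      have h1 : m i = 0 := Finsupp.notMem_support_iff.1 fun hh => hiS (hfS m hfm hh)
      have h2 : k i = 0 := Finsupp.notMem_support_iff.1 fun hh => hiS (hk hh)
      exact hi (by rw [h1, h2])
    refine mul_eq_zero_of_right _ (Finset.prod_eq_zero (Finset.mem_univ ⟨i, hiS⟩) ?_)
    apply integral_fourier_haar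
    simp only [ne_eq, sub_eq_zero]
    exact_mod_cast hi
  have hk1 : ∫ θ, G k θ ∂μ = f k := by
    rw [hint]; simp
  have hsum : ∑' m, ∫ θ, G m θ ∂μ = ∫ θ, ∑' m, G m θ ∂μ := by
    refine integral_tsum_of_summable_integral_norm hGi ?_
    simpa [hGn] using hf
  rw [tsum_eq_single k h0, hk1] at hsum
  rw [hsum]
  have hb : ∀ θ, ‖∑' m, G m θ‖ ≤ M := by
    intro θ
    let u : ℕ → ℂ := fun i => if h : i ∈ S then fourier 1 (θ ⟨i, h⟩) else 1
    have hu : ∀ i, ‖u i‖ = 1 := by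
      intro i
      simp only [u]
      split_ifs
      · rw [fourier_apply]; exact Circle.norm_coe _
      · simp
    have hG : ∀ m, G m θ = (∏ i : S, fourier (-(k i : ℤ)) (θ i)) * (f m * monom m u) := by
      intro m
      by_cases hfm : f m = 0
      · simp [G, hfm]
      have : monom m u = ∏ i : S, fourier (m i : ℤ) (θ i) := by
        unfold monom
        rw [prodpow_eq m u S (hfS m hfm), ← Finset.prod_coe_sort]
        refine Finset.prod_congr rfl fun i _ => ?_
        simp [u, fourier_apply, AddCircle.toCircle_nsmul]
      simp only [G, this, sub_eq_add_neg, fourier_add, Finset.prod_mul_distrib]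
      ring
    simp only [hG]
    rw [tsum_mul_left, norm_mul]
    have : ‖∏ i : S, fourier (-(k i : ℤ)) (θ i)‖ = 1 := by
      simp only [norm_prod, fourier_apply, Circle.norm_coe, Finset.prod_const_one]
    rw [this, one_mul]
    exact hM u hu
  have := norm_integral_le_of_norm_le_const (μ := μ) (Filter.Eventually.of_forall hb)
  simpa [μ] using this

lemma l1_summable (z : L1) : Summable fun i => ‖z i‖ := by
  have := (lp.memℓp z).summable (by simp)
  simpa using this

lemma l1_norm (z : L1) : ‖z‖ = ∑' i, ‖z i‖ := by
  rw [lp.norm_eq_tsum_rpow (by simp)]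
  simp

lemma sum_single_apply (S : Finset ℕ) (t : ℕ → ℂ) (ht : ∀ i, i ∉ S → t i = 0) (j : ℕ) :
    (∑ i ∈ S, lp.single (E := fun _ : ℕ => ℂ) 1 i (t i) : L1) j = t j := by
  simp only [lp.coeFn_sum, lp.coeFn_single, Finset.sum_apply, Finset.sum_pi_single]
  split_ifs with h
  · rfl
  · exact (ht j h).symm

lemma norm_sum_single1 (S : Finset ℕ) (t : ℕ → ℂ) :
    ‖(∑ i ∈ S, lp.single (E := fun _ : ℕ => ℂ) 1 i (t i) : L1)‖ = ∑ i ∈ S, ‖t i‖ := by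
  have := lp.norm_sum_single (E := fun _ : ℕ => ℂ) (p := 1) (by simp) t S
  simpa using this

/-- the finitely supported points of the image of the unit ball under the diagonal operator -/
def Aset (σ : ℕ → ℝ) : Set L1 :=
  {z | ∃ (S : Finset ℕ) (t : ℕ → ℂ), (∀ i, i ∉ S → t i = 0) ∧ ∑ i ∈ S, ‖t i‖ ≤ 1 ∧
    z = ∑ i ∈ S, lp.single (E := fun _ : ℕ => ℂ) 1 i (σ i * t i)}

lemma Aset_totallyBounded (σ : ℕ → ℝ) (hσ : ∀ i, 0 ≤ σ i)
    (hlim : Filter.Tendsto σ Filter.atTop (nhds 0)) : TotallyBounded (Aset σ) := by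
  rw [Metric.totallyBounded_iff]
  intro ε hε
  obtain ⟨N, hN⟩ := Filter.eventually_atTop.1
    (hlim.eventually (gt_mem_nhds (show (0 : ℝ) < ε / 2 by positivity)))
  let Ψ : (ℕ → ℂ) → L1 := fun t =>
    ∑ i ∈ Finset.range N, lp.single (E := fun _ : ℕ => ℂ) 1 i (σ i * t i)
  have hΨ : Continuous Ψ := by
    refine continuous_finsetSum _ fun i _ => ?_
    refine (lp.isometry_single (E := fun _ : ℕ => ℂ) (p := 1) i).continuous.comp ?_
    fun_prop
  have hcomp : IsCompact (Ψ '' (Set.pi univ fun _ : ℕ => Metric.closedBall (0 : ℂ) 1)) :=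
    (isCompact_univ_pi fun _ => isCompact_closedBall _ _).image hΨ
  obtain ⟨Y, hYf, hY⟩ := Metric.totallyBounded_iff.1 hcomp.totallyBounded (ε / 2) (by positivity)
  refine ⟨Y, hYf, ?_⟩
  rintro z ⟨S, t, ht0, hts, rfl⟩
  have ht1 : ∀ i, ‖t i‖ ≤ 1 := by
    intro i
    by_cases hi : i ∈ S
    · exact (Finset.single_le_sum (f := fun i => ‖t i‖) (fun j _ => norm_nonneg _) hi).trans hts
    · simp [ht0 i hi]
  have hmem : Ψ t ∈ Ψ '' (Set.pi univ fun _ : ℕ => Metric.closedBall (0 : ℂ) 1) :=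
    ⟨t, fun i _ => by simpa using ht1 i, rfl⟩
  obtain ⟨y, hy, hyd⟩ := mem_iUnion₂.1 (hY hmem)
  refine mem_iUnion₂.2 ⟨y, hy, ?_⟩
  rw [Metric.mem_ball] at hyd ⊢
  have hd : dist (∑ i ∈ S, lp.single (E := fun _ : ℕ => ℂ) 1 i (σ i * t i)) (Ψ t) ≤ ε / 2 := by
    have hΨ2 : Ψ t = ∑ i ∈ S.filter (fun i => i < N),
        lp.single (E := fun _ : ℕ => ℂ) 1 i (σ i * t i) := by
      symm
      refine Finset.sum_subset (fun i hi => by simpa using (Finset.mem_filter.1 hi).2) ?_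
      intro i hi hni
      have : i ∉ S := fun h => hni (Finset.mem_filter.2 ⟨h, by simpa using hi⟩)
      simp [ht0 i this]
    rw [dist_eq_norm, hΨ2, ← Finset.sum_filter_add_sum_filter_not S (fun i => i < N),
      add_sub_cancel_left, norm_sum_single1]
    calc _ ≤ ∑ i ∈ S.filter (fun i => ¬ i < N), (ε / 2) * ‖t i‖ := by
          refine Finset.sum_le_sum fun i hi => ?_
          have hi2 := (Finset.mem_filter.1 hi).2
          rw [norm_mul, Complex.norm_real, Real.norm_of_nonneg (hσ i)]
          exact mul_le_mul_of_nonneg_right (hN i (by omega)).le (norm_nonneg _)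
      _ ≤ ∑ i ∈ S, (ε / 2) * ‖t i‖ :=
          Finset.sum_le_sum_of_subset_of_nonneg (Finset.filter_subset _ _)
            fun i _ _ => by positivity
      _ = (ε / 2) * ∑ i ∈ S, ‖t i‖ := by rw [Finset.mul_sum]
      _ ≤ ε / 2 * 1 := by gcongr
      _ = _ := by ring
  calc _ ≤ _ := dist_triangle _ (Ψ t) _
    _ < ε / 2 + ε / 2 := by linarith
    _ = ε := by ring

lemma sigma_sup (R : ℝ≥0∞) (hR : 0 < R) (σ : ℕ → ℝ)
    (hσR : ∀ ν, ENNReal.ofReal (σ ν) < R)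
    (hlim : Filter.Tendsto σ Filter.atTop (nhds 0)) :
    ∃ s : ℝ, 0 < s ∧ ENNReal.ofReal s < R ∧ ∀ i, σ i < s := by
  obtain ⟨s0, hs0, hs0R⟩ : ∃ s0 : ℝ, 0 < s0 ∧ ENNReal.ofReal s0 < R := by
    obtain ⟨q, hq, hq1, hq2⟩ := ENNReal.lt_iff_exists_real_btwn.1 hR
    exact ⟨q, by simpa using hq1, hq2⟩
  obtain ⟨N, hN⟩ := Filter.eventually_atTop.1 (hlim.eventually (gt_mem_nhds hs0))
  have hfin : ∀ n : ℕ, ∃ s : ℝ, 0 < s ∧ ENNReal.ofReal s < R ∧ s0 ≤ s ∧ ∀ i < n, σ i < s := by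
    intro n
    induction n with
    | zero => exact ⟨s0, hs0, hs0R, le_rfl, by simp⟩
    | succ n ih =>
      obtain ⟨s, hs, hsR, h0, hi⟩ := ih
      obtain ⟨q, hq, hq1, hq2⟩ := ENNReal.lt_iff_exists_real_btwn.1 (hσR n)
      have hq1' : σ n < q := by
        by_contra! hcon
        exact absurd hq1 (not_lt.2 (ENNReal.ofReal_le_ofReal hcon))
      refine ⟨max s q, lt_max_of_lt_left hs, ?_, le_max_of_le_left h0, fun i hin => ?_⟩
      · rcases max_cases s q with ⟨h, _⟩ | ⟨h, _⟩ <;> rw [h] <;> assumption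
      · rcases Nat.lt_succ_iff_lt_or_eq.1 hin with h | rfl
        · exact lt_max_of_lt_left (hi i h)
        · exact lt_max_of_lt_right hq1'
  obtain ⟨s, hs, hsR, h0, hi⟩ := hfin N
  refine ⟨s, hs, hsR, fun i => ?_⟩
  rcases lt_or_ge i N with h | h
  · exact hi i h
  · exact (hN i h).trans_le h0

lemma nn_lt_of (R : ℝ≥0∞) (s : ℝ) (hs : ENNReal.ofReal s < R) (z : L1) (hz : ‖z‖ ≤ s) :
    (‖z‖₊ : ℝ≥0∞) < R := by
  refine lt_of_le_of_lt ?_ hs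
  rw [← enorm_eq_nnnorm, ← ofReal_norm]
  exact ENNReal.ofReal_le_ofReal hz

lemma Aset_bounded (R : ℝ≥0∞) (hR : 0 < R) (h : L1 → ℂ)
    (hol : DifferentiableOn ℂ h {z : L1 | (‖z‖₊ : ℝ≥0∞) < R})
    (σ : ℕ → ℝ) (hσ : ∀ i, 0 ≤ σ i) (hσR : ∀ ν, ENNReal.ofReal (σ ν) < R)
    (hlim : Filter.Tendsto σ Filter.atTop (nhds 0)) :
    (∀ z ∈ Aset σ, (‖z‖₊ : ℝ≥0∞) < R) ∧ ∃ M : ℝ, ∀ z ∈ Aset σ, ‖h z‖ ≤ M := by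
  obtain ⟨s, hs, hsR, hσs⟩ := sigma_sup R hR σ hσR hlim
  have hball : Aset σ ⊆ Metric.closedBall 0 s := by
    rintro z ⟨S, t, ht0, hts, rfl⟩
    rw [mem_closedBall_zero_iff, norm_sum_single1]
    calc _ ≤ ∑ i ∈ S, s * ‖t i‖ := by
          refine Finset.sum_le_sum fun i hi => ?_
          rw [norm_mul, Complex.norm_real, Real.norm_of_nonneg (hσ i)]
          exact mul_le_mul_of_nonneg_right (hσs i).le (norm_nonneg _)
      _ = s * ∑ i ∈ S, ‖t i‖ := by rw [Finset.mul_sum]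
      _ ≤ s * 1 := by gcongr
      _ = s := mul_one s
  have hsub : Metric.closedBall (0 : L1) s ⊆ {z : L1 | (‖z‖₊ : ℝ≥0∞) < R} := fun z hz =>
    nn_lt_of R s hsR z (by simpa using hz)
  refine ⟨fun z hz => hsub (hball hz), ?_⟩
  have hc : IsCompact (closure (Aset σ)) :=
    (Aset_totallyBounded σ hσ hlim).closure.isCompact_of_isClosed isClosed_closure
  have hcl : closure (Aset σ) ⊆ {z : L1 | (‖z‖₊ : ℝ≥0∞) < R} :=
    (closure_minimal hball Metric.isClosed_closedBall).trans hsub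
  obtain ⟨M, hM⟩ := hc.exists_bound_of_continuousOn (hol.continuousOn.mono hcl)
  exact ⟨M, fun z hz => hM z (subset_closure hz)⟩

lemma monom_mul (k : ℕ →₀ ℕ) (z w : ℕ → ℂ) :
    monom k (fun i => z i * w i) = monom k z * monom k w := by
  simp only [monom, mul_pow, Finset.prod_mul_distrib]

lemma coeff_bound (R : ℝ≥0∞) (h : L1 → ℂ)
    (a : (ℕ →₀ ℕ) → ℂ)
    (ha : ∀ z : L1, (‖z‖₊ : ℝ≥0∞) < R → {ν : ℕ | z ν ≠ 0}.Finite →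
      Summable (fun k => ‖a k * monom k (fun ν => z ν)‖) ∧
      HasSum (fun k => a k * monom k (fun ν => z ν)) (h z))
    (σ : ℕ → ℝ) (hσ : ∀ i, 0 ≤ σ i) (hA : ∀ z ∈ Aset σ, (‖z‖₊ : ℝ≥0∞) < R)
    (M : ℝ) (hM : ∀ z ∈ Aset σ, ‖h z‖ ≤ M) (k : ℕ →₀ ℕ) :
    ‖a k‖ * (∏ ν ∈ k.support, σ ν ^ k ν) * kk k / nn k ≤ M := by
  classical
  set S := k.support with hS
  set n := knormN k with hn
  let t : ℕ → ℂ := fun i => ((k i : ℝ) / (n : ℝ) : ℝ)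
  have ht0 : ∀ i, i ∉ S → t i = 0 := by
    intro i hi
    simp [t, Finsupp.notMem_support_iff.1 hi]
  let v : ℕ → ℂ := fun i => σ i * t i
  let Z : (ℕ → ℂ) → L1 := fun u =>
    ∑ i ∈ S, lp.single (E := fun _ : ℕ => ℂ) 1 i (σ i * (t i * u i))
  have hZc : ∀ u j, Z u j = v j * u j := by
    intro u j
    simp only [Z]
    rw [sum_single_apply S (fun i => σ i * (t i * u i)) (fun i hi => by simp [ht0 i hi])]
    simp only [v]; ring
  have hZA : ∀ u : ℕ → ℂ, (∀ i, ‖u i‖ = 1) → Z u ∈ Aset σ := by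
    intro u hu
    refine ⟨S, fun i => t i * u i, fun i hi => by simp [ht0 i hi], ?_, rfl⟩
    have : ∑ i ∈ S, ‖t i * u i‖ = (n : ℝ) / n := by
      have h1 : ∀ i ∈ S, ‖t i * u i‖ = (k i : ℝ) / n := by
        intro i _
        rw [norm_mul, hu, mul_one]
        simp only [t]
        rw [Complex.norm_real, Real.norm_of_nonneg (by positivity)]
      rw [Finset.sum_congr rfl h1, ← Finset.sum_div, hn, knormN_eq k S subset_rfl]
      push_cast
      rfl
    rw [this]
    exact div_self_le_one _
  have hZfin : ∀ u, {ν : ℕ | Z u ν ≠ 0}.Finite := by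
    intro u
    refine S.finite_toSet.subset fun i hi => ?_
    by_contra hiS
    apply hi
    rw [hZc]
    simp [v, ht0 i hiS]
  have hmon : ∀ u m, a m * monom m (fun ν => Z u ν) = a m * monom m v * monom m u := by
    intro u m
    have : (fun ν => Z u ν) = fun ν => v ν * u ν := funext (hZc u)
    rw [this, monom_mul, mul_assoc]
  have key := torus_coeff S (fun m => a m * monom m v) ?_ ?_ M ?_ k subset_rfl
  · refine le_trans (le_of_eq ?_) key
    rw [norm_mul]
    have h1 : ‖monom k v‖ = (∏ ν ∈ k.support, σ ν ^ k ν) * kk k / nn k := by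
      simp only [monom, kk, nn, norm_prod, norm_pow]
      have h2 : ∀ i ∈ k.support, ‖v i‖ ^ k i = σ i ^ k i * (k i : ℝ) ^ k i / (n : ℝ) ^ k i := by
        intro i _
        simp only [v, t, norm_mul]
        rw [Complex.norm_real, Complex.norm_real, Real.norm_of_nonneg (hσ i),
          Real.norm_of_nonneg (by positivity), mul_pow, div_pow, mul_div_assoc]
      rw [Finset.prod_congr rfl h2, Finset.prod_div_distrib, Finset.prod_mul_distrib,
        Finset.prod_pow_eq_pow_sum, ← knormN_eq k k.support subset_rfl]
    rw [h1]
    ring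
  · have := (ha (Z fun _ => 1) (hA _ (hZA _ (by simp))) (hZfin _)).1
    simp only [hmon] at this
    simpa [monom] using this
  · intro m hm i hi
    by_contra hiS
    apply hm
    refine mul_eq_zero_of_right _ (Finset.prod_eq_zero hi ?_)
    simp only [v, ht0 i hiS, mul_zero]
    exact zero_pow (Finsupp.mem_support_iff.1 hi)
  · intro u hu
    have := (ha (Z u) (hA _ (hZA _ hu)) (hZfin _)).2
    simp only [hmon] at this
    rw [this.tsum_eq]
    exact hM _ (hZA u hu)

lemma rho_finite (ρ : ℕ → ℝ) (h0 : ∀ i, 0 ≤ ρ i) (h1 : ∀ i, ρ i < 1)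
    (hlim : Filter.Tendsto ρ Filter.atTop (nhds 0)) (M ε : ℝ) (hε : 0 < ε) :
    {k : ℕ →₀ ℕ | ε ≤ M * ∏ ν ∈ k.support, ρ ν ^ k ν}.Finite := by
  obtain ⟨r, hr0, hr1, hr⟩ := sigma_sup 1 one_pos ρ
    (fun i => by simpa using h1 i) hlim
  have hr1' : r < 1 := by simpa using hr1
  set δ := ε / max M 1 with hδ
  have hM : 0 < max M 1 := lt_max_of_lt_right one_pos
  have hδ0 : 0 < δ := by positivity
  obtain ⟨N, hN⟩ := Filter.eventually_atTop.1 (hlim.eventually (gt_mem_nhds hδ0))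
  obtain ⟨P, hP⟩ := exists_pow_lt_of_lt_one hδ0 hr1'
  refine (Set.finite_Iic (∑ i ∈ Finset.range N, Finsupp.single i P)).subset ?_
  intro k hk
  rw [Set.mem_Iic, Finsupp.le_def]
  intro i
  by_cases hi : i ∈ k.support
  · have hki : 1 ≤ k i := Nat.one_le_iff_ne_zero.2 (Finsupp.mem_support_iff.1 hi)
    have hle : ∏ ν ∈ k.support, ρ ν ^ k ν ≤ ρ i ^ k i := by
      rw [← Finset.mul_prod_erase _ _ hi]
      refine mul_le_of_le_one_right (pow_nonneg (h0 i) _) ?_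
      exact Finset.prod_le_one (fun j _ => pow_nonneg (h0 j) _)
        fun j _ => pow_le_one₀ (h0 j) (h1 j).le
    have hp0 : 0 ≤ ∏ ν ∈ k.support, ρ ν ^ k ν := Finset.prod_nonneg fun j _ => pow_nonneg (h0 j) _
    have hδle : δ ≤ ρ i ^ k i := by
      rw [hδ, div_le_iff₀ hM]
      have hk' : ε ≤ M * ∏ ν ∈ k.support, ρ ν ^ k ν := hk
      calc ε ≤ _ := hk'
        _ ≤ max M 1 * ∏ ν ∈ k.support, ρ ν ^ k ν := by gcongr; exact le_max_left _ _
        _ ≤ max M 1 * ρ i ^ k i := by gcongr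
        _ = _ := mul_comm _ _
    have hiN : i < N := by
      by_contra! hcon
      have h2 : ρ i ^ k i ≤ ρ i := pow_le_of_le_one (h0 i) (h1 i).le (by omega)
      linarith [hN i hcon]
    have hkP : k i ≤ P := by
      by_contra! hcon
      have h2 : ρ i ^ k i ≤ r ^ k i := pow_le_pow_left₀ (h0 i) (hr i).le _
      have h3 : r ^ k i ≤ r ^ P := pow_le_pow_of_le_one hr0.le hr1'.le hcon.le
      linarith
    rw [Finsupp.finsetSum_apply]
    simp only [Finsupp.single_apply, Finset.sum_ite_eq', Finset.mem_range, hiN, if_true]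
    exact hkP
  · rw [Finsupp.notMem_support_iff.1 hi]; exact Nat.zero_le _

lemma part3 (R : ℝ≥0∞) (hR : 0 < R) (h : L1 → ℂ)
    (hol : DifferentiableOn ℂ h {z : L1 | (‖z‖₊ : ℝ≥0∞) < R})
    (a : (ℕ →₀ ℕ) → ℂ)
    (ha : ∀ z : L1, (‖z‖₊ : ℝ≥0∞) < R → {ν : ℕ | z ν ≠ 0}.Finite →
      Summable (fun k => ‖a k * monom k (fun ν => z ν)‖) ∧
      HasSum (fun k => a k * monom k (fun ν => z ν)) (h z))
    (σ : ℕ → ℝ) (hσ : ∀ ν, 0 ≤ σ ν) (hσR : ∀ ν, ENNReal.ofReal (σ ν) < R)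
    (hlim : Filter.Tendsto σ Filter.atTop (nhds 0)) (ε : ℝ) (hε : 0 < ε) :
    {k : ℕ →₀ ℕ | ε ≤ ‖a k‖ * (∏ ν ∈ k.support, σ ν ^ k ν) * kk k / nn k}.Finite := by
  obtain ⟨s, hs, hsR, hσs⟩ := sigma_sup R hR σ hσR hlim
  let σ' : ℕ → ℝ := fun i => √(s * σ i)
  let ρ : ℕ → ℝ := fun i => √(σ i / s)
  have hmul : ∀ i, σ i = σ' i * ρ i := by
    intro i
    simp only [σ', ρ]
    rw [← Real.sqrt_mul (mul_nonneg hs.le (hσ i))]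
    have : s * σ i * (σ i / s) = σ i ^ 2 := by field_simp
    rw [this, Real.sqrt_sq (hσ i)]
  have hσ's : ∀ i, σ' i ≤ s := by
    intro i
    simp only [σ']
    rw [Real.sqrt_le_left hs.le]
    nlinarith [hσs i]
  have hσ'lim : Filter.Tendsto σ' Filter.atTop (nhds 0) := by
    have := (hlim.const_mul s).sqrt
    simpa using this
  have hρlim : Filter.Tendsto ρ Filter.atTop (nhds 0) := by
    have := (hlim.div_const s).sqrt
    simpa using this
  obtain ⟨hA, M, hM⟩ := Aset_bounded R hR h hol σ' (fun i => Real.sqrt_nonneg _)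
    (fun i => (ENNReal.ofReal_le_ofReal (hσ's i)).trans_lt hsR) hσ'lim
  refine (rho_finite ρ (fun i => Real.sqrt_nonneg _) (fun i => ?_) hρlim M ε hε).subset ?_
  · simp only [ρ]
    rw [Real.sqrt_lt' one_pos, one_pow, div_lt_one hs]
    exact hσs i
  · intro k hk
    have hk' : ε ≤ ‖a k‖ * (∏ ν ∈ k.support, σ ν ^ k ν) * kk k / nn k := hk
    have h1 := coeff_bound R h a ha σ' (fun i => Real.sqrt_nonneg _) hA M hM k
    have h2 : ∏ ν ∈ k.support, σ ν ^ k ν =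
        (∏ ν ∈ k.support, σ' ν ^ k ν) * ∏ ν ∈ k.support, ρ ν ^ k ν := by
      rw [← Finset.prod_mul_distrib]
      exact Finset.prod_congr rfl fun i _ => by rw [hmul i, mul_pow]
    have h3 : 0 ≤ ∏ ν ∈ k.support, ρ ν ^ k ν :=
      Finset.prod_nonneg fun i _ => pow_nonneg (Real.sqrt_nonneg _) _
    calc ε ≤ _ := hk'
      _ = ‖a k‖ * (∏ ν ∈ k.support, σ' ν ^ k ν) * kk k / nn k * ∏ ν ∈ k.support, ρ ν ^ k ν := by
        rw [h2]; ring
      _ ≤ _ := mul_le_mul_of_nonneg_right h1 h3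

/-- the tail of the norm series -/
def tl (n : ℕ) (z : L1) : ℝ := ∑' i, ‖z (i + n)‖

lemma tl_summable (n : ℕ) (z : L1) : Summable fun i => ‖z (i + n)‖ :=
  (summable_nat_add_iff (f := fun i => ‖z i‖) n).2 (l1_summable z)

lemma tl_nonneg (n : ℕ) (z : L1) : 0 ≤ tl n z := tsum_nonneg fun _ => norm_nonneg _

lemma tl_succ (n : ℕ) (z : L1) : tl n z = ‖z n‖ + tl (n + 1) z := by
  unfold tl
  rw [(tl_summable n z).tsum_eq_zero_add, zero_add]
  congr 1
  refine tsum_congr fun i => ?_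
  rw [show i + 1 + n = i + (n + 1) by ring]

lemma tl_anti (z : L1) : Antitone fun n => tl n z :=
  antitone_nat_of_succ_le fun n => by rw [tl_succ n z]; linarith [norm_nonneg (z n)]

lemma tl_le (n : ℕ) (z : L1) : tl n z ≤ ‖z‖ := by
  have := tl_anti z (Nat.zero_le n)
  have h0 : tl 0 z = ‖z‖ := by rw [l1_norm]; rfl
  simpa [h0] using this

lemma tl_cont (n : ℕ) : Continuous (tl n) := by
  refine (LipschitzWith.of_le_add (f := tl n) fun z w => ?_).continuous
  calc tl n z ≤ ∑' i, (‖w (i + n)‖ + ‖(z - w) (i + n)‖) := by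
        refine (tl_summable n z).tsum_le_tsum (fun i => ?_)
          ((tl_summable n w).add (tl_summable n (z - w)))
        have : z (i + n) = w (i + n) + (z - w) (i + n) := by simp
        calc ‖z (i + n)‖ = ‖w (i + n) + (z - w) (i + n)‖ := by rw [← this]
          _ ≤ _ := norm_add_le _ _
    _ = tl n w + tl n (z - w) := (tl_summable n w).tsum_add (tl_summable n (z - w))
    _ ≤ tl n w + dist z w := by rw [dist_eq_norm]; linarith [tl_le n (z - w)]

lemma tl_tendsto (z : L1) : Filter.Tendsto (fun n => tl n z) Filter.atTop (nhds 0) :=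
  tendsto_sum_nat_add fun i => ‖z i‖

lemma tele (z : L1) (τ : ℕ → ℝ) (hτ : ∀ i, tl i z ≤ τ i) (N P : ℕ) (hNP : N ≤ P) :
    ∑ i ∈ Finset.Ico N P, ‖z i‖ / √(τ i) ≤ 2 * (√(tl N z) - √(tl P z)) := by
  induction P, hNP using Nat.le_induction with
  | base => simp
  | succ P hP ih =>
    rw [Finset.sum_Ico_succ_top hP]
    have hstep : ‖z P‖ / √(τ P) ≤ 2 * (√(tl P z) - √(tl (P + 1) z)) := by
      have hs := tl_succ P z
      have hle : tl (P + 1) z ≤ tl P z := tl_anti z (Nat.le_succ P)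
      have hsq := Real.sqrt_le_sqrt hle
      rcases (tl_nonneg P z).eq_or_lt with h0 | h0
      · have : ‖z P‖ = 0 := by
          have := tl_nonneg (P + 1) z
          linarith [norm_nonneg (z P)]
        rw [this, zero_div]
        linarith
      · have hpos : 0 < √(tl P z) := Real.sqrt_pos.2 h0
        have hpos' : √(tl P z) ≤ √(τ P) := Real.sqrt_le_sqrt (hτ P)
        calc ‖z P‖ / √(τ P) ≤ ‖z P‖ / √(tl P z) := by gcongr
          _ ≤ _ := by
            rw [div_le_iff₀ hpos]
            have e1 := Real.mul_self_sqrt (tl_nonneg P z)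
            have e2 := Real.mul_self_sqrt (tl_nonneg (P + 1) z)
            nlinarith [Real.sqrt_nonneg (tl (P + 1) z)]
    linarith

lemma compact_sigma (R : ℝ≥0∞) (hR : 0 < R) (K : Set L1)
    (hKR : K ⊆ {z : L1 | (‖z‖₊ : ℝ≥0∞) < R}) (hK : IsCompact K) :
    ∃ σ : ℕ → ℝ, (∀ i, 0 ≤ σ i) ∧ (∀ i, ENNReal.ofReal (σ i) < R) ∧
      Filter.Tendsto σ Filter.atTop (nhds 0) ∧
      ∃ c : ℝ, 1 < c ∧ ∃ N : ℕ, ∃ θ : ℝ, θ < 1 ∧ ∀ z ∈ K, ∃ w : ℕ → ℝ,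
        (∀ i, 0 ≤ w i) ∧ (∀ i, ‖z i‖ = w i * σ i) ∧
        ∀ T : Finset ℕ, ∑ i ∈ T, (if i < N then c else Real.exp 1) * w i ≤ θ := by
  classical
  obtain ⟨s, hs0, hsR, hKs⟩ : ∃ s : ℝ, 0 ≤ s ∧ ENNReal.ofReal s < R ∧ ∀ z ∈ K, ‖z‖ ≤ s := by
    rcases K.eq_empty_or_nonempty with rfl | hne
    · exact ⟨0, le_rfl, by simpa using hR, by simp⟩
    · obtain ⟨z0, hz0, hmax⟩ := hK.exists_isMaxOn hne continuous_norm.continuousOn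
      refine ⟨‖z0‖, norm_nonneg _, ?_, fun z hz => hmax hz⟩
      rw [ofReal_norm, enorm_eq_nnnorm]
      exact hKR hz0
  obtain ⟨s', hs'0, hs1, hs2⟩ := ENNReal.lt_iff_exists_real_btwn.1 hsR
  have hss' : s < s' := by
    by_contra! hcon
    exact absurd hs1 (not_lt.2 (ENNReal.ofReal_le_ofReal hcon))
  have hs'pos : 0 < s' := hs0.trans_lt hss'
  let τ : ℕ → ℝ := fun n => sSup ((fun z => tl n z) '' K)
  have hbdd : ∀ n, BddAbove ((fun z => tl n z) '' K) := by
    intro n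
    refine ⟨s, ?_⟩
    rintro _ ⟨z, hz, rfl⟩
    exact (tl_le n z).trans (hKs z hz)
  have hτle : ∀ z ∈ K, ∀ n, tl n z ≤ τ n := fun z hz n => le_csSup (hbdd n) ⟨z, hz, rfl⟩
  have hτ0 : ∀ n, 0 ≤ τ n := by
    intro n
    refine Real.sSup_nonneg ?_
    rintro _ ⟨z, hz, rfl⟩
    exact tl_nonneg n z
  have hτlim : Filter.Tendsto τ Filter.atTop (nhds 0) := by
    have hu : TendstoUniformlyOn tl (fun _ => 0) Filter.atTop K :=
      Antitone.tendstoUniformlyOn_of_forall_tendsto hK (fun n => (tl_cont n).continuousOn)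
        (fun z _ => tl_anti z) continuousOn_const (fun z _ => tl_tendsto z)
    rw [Metric.tendstoUniformlyOn_iff] at hu
    rw [Metric.tendsto_atTop]
    intro ε hε
    obtain ⟨N, hN⟩ := Filter.eventually_atTop.1 (hu (ε / 2) (by positivity))
    refine ⟨N, fun n hn => ?_⟩
    rw [Real.dist_eq, sub_zero, abs_of_nonneg (hτ0 n)]
    refine lt_of_le_of_lt (Real.sSup_le ?_ (by positivity)) (half_lt_self hε)
    rintro _ ⟨z, hz, rfl⟩
    have := hN n hn z hz
    rw [dist_comm, Real.dist_eq, sub_zero, abs_of_nonneg (tl_nonneg n z)] at this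
    exact this.le
  have hsτ : Filter.Tendsto (fun n => √(τ n)) Filter.atTop (nhds 0) := by
    simpa using hτlim.sqrt
  have hq : 2 * s / (s' + s) < 1 := by
    rw [div_lt_one (by positivity)]; linarith
  set q := 2 * s / (s' + s) with hqdef
  have hδ : 0 < (1 - q) / 2 / (2 * Real.exp 1) := by
    have : 0 < 1 - q := by linarith
    positivity
  obtain ⟨N, hN⟩ := Filter.eventually_atTop.1
    ((hsτ.eventually (gt_mem_nhds hs'pos)).and (hsτ.eventually (gt_mem_nhds hδ)))
  let σ : ℕ → ℝ := fun i => if i < N then s' else √(τ i)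
  refine ⟨σ, fun i => ?_, fun i => ?_, ?_, 2 * s' / (s' + s), ?_, N, (1 + q) / 2, by linarith, ?_⟩
  · simp only [σ]; split_ifs <;> positivity
  · refine lt_of_le_of_lt (ENNReal.ofReal_le_ofReal ?_) hs2
    simp only [σ]
    split_ifs with hi
    · exact le_rfl
    · exact (hN i (by omega)).1.le
  · refine hsτ.congr' ?_
    filter_upwards [Filter.eventually_ge_atTop N] with i hi
    simp only [σ]
    rw [if_neg (by omega)]
  · rw [one_lt_div (by positivity)]; linarith
  intro z hz
  have hz0 : ∀ i, 0 ≤ ‖z i‖ / σ i := by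
    intro i
    refine div_nonneg (norm_nonneg _) ?_
    simp only [σ]; split_ifs <;> positivity
  refine ⟨fun i => ‖z i‖ / σ i, hz0, fun i => ?_, fun T => ?_⟩
  · by_cases h0 : σ i = 0
    · have hi : ¬ i < N := by
        intro hi
        simp only [σ, if_pos hi] at h0
        exact hs'pos.ne' h0
      simp only [σ, if_neg hi] at h0
      have h1 : τ i = 0 := (Real.sqrt_eq_zero (hτ0 i)).1 h0
      have h2 := hτle z hz i
      have h3 := tl_succ i z
      have h4 := tl_nonneg (i + 1) z
      have : ‖z i‖ = 0 := le_antisymm (by linarith) (norm_nonneg _)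
      simp [this]
    · simp only
      field_simp
  · rw [← Finset.sum_filter_add_sum_filter_not T (fun i => i < N)]
    have hA : ∑ i ∈ T.filter (fun i => i < N),
        (if i < N then 2 * s' / (s' + s) else Real.exp 1) * (‖z i‖ / σ i) ≤ q := by
      calc _ = ∑ i ∈ T.filter (fun i => i < N), (2 / (s' + s)) * ‖z i‖ := by
            refine Finset.sum_congr rfl fun i hi => ?_
            have hi2 := (Finset.mem_filter.1 hi).2
            simp only [σ, if_pos hi2]
            field_simp
        _ = (2 / (s' + s)) * ∑ i ∈ T.filter (fun i => i < N), ‖z i‖ := by rw [Finset.mul_sum]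
        _ ≤ (2 / (s' + s)) * s := by
            refine mul_le_mul_of_nonneg_left ?_ (by positivity)
            refine le_trans ?_ (hKs z hz)
            rw [l1_norm]
            exact (l1_summable z).sum_le_tsum _ fun i _ => norm_nonneg _
        _ = q := by rw [hqdef]; ring
    have hB : ∑ i ∈ T.filter (fun i => ¬ i < N),
        (if i < N then 2 * s' / (s' + s) else Real.exp 1) * (‖z i‖ / σ i) ≤ (1 - q) / 2 := by
      calc _ = ∑ i ∈ T.filter (fun i => ¬ i < N), Real.exp 1 * (‖z i‖ / √(τ i)) := by
            refine Finset.sum_congr rfl fun i hi => ?_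
            have hi2 := (Finset.mem_filter.1 hi).2
            simp only [σ, if_neg hi2]
        _ ≤ ∑ i ∈ Finset.Ico N (N + T.sup id + 1), Real.exp 1 * (‖z i‖ / √(τ i)) := by
            refine Finset.sum_le_sum_of_subset_of_nonneg ?_ fun i _ _ => by positivity
            intro i hi
            obtain ⟨h1, h2⟩ := Finset.mem_filter.1 hi
            have h3 : i ≤ T.sup id := Finset.le_sup (f := id) h1
            rw [Finset.mem_Ico]
            omega
        _ = Real.exp 1 * ∑ i ∈ Finset.Ico N (N + T.sup id + 1), ‖z i‖ / √(τ i) := by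
            rw [Finset.mul_sum]
        _ ≤ Real.exp 1 * (2 * √(τ N)) := by
            refine mul_le_mul_of_nonneg_left ?_ (by positivity)
            refine (tele z τ (hτle z hz) N _ (by omega)).trans ?_
            have := Real.sqrt_le_sqrt (hτle z hz N)
            linarith [Real.sqrt_nonneg (tl (N + T.sup id + 1) z)]
        _ ≤ (1 - q) / 2 := by
            have := (hN N le_rfl).2
            rw [lt_div_iff₀ (by positivity)] at this
            linarith
    linarith

lemma key_unif (R : ℝ≥0∞) (hR : 0 < R) (h : L1 → ℂ)
    (hol : DifferentiableOn ℂ h {z : L1 | (‖z‖₊ : ℝ≥0∞) < R})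
    (a : (ℕ →₀ ℕ) → ℂ)
    (ha : ∀ z : L1, (‖z‖₊ : ℝ≥0∞) < R → {ν : ℕ | z ν ≠ 0}.Finite →
      Summable (fun k => ‖a k * monom k (fun ν => z ν)‖) ∧
      HasSum (fun k => a k * monom k (fun ν => z ν)) (h z))
    (K : Set L1) (hKR : K ⊆ {z : L1 | (‖z‖₊ : ℝ≥0∞) < R}) (hK : IsCompact K)
    (ε : ℝ) (hε : 0 < ε) :
    ∃ F : Finset (ℕ →₀ ℕ), ∀ z ∈ K, ∀ G : Finset (ℕ →₀ ℕ), (∀ k ∈ G, k ∉ F) →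
      ∑ k ∈ G, ‖a k * monom k (fun ν => z ν)‖ ≤ ε := by
  obtain ⟨σ, hσ, hσR, hlim, c, hc, N, θ, hθ, hw⟩ := compact_sigma R hR K hKR hK
  obtain ⟨C, hC0, hC⟩ := delta_bound c hc N θ hθ
  have hfin := part3 R hR h hol a ha σ hσ hσR hlim (ε / (C + 1)) (by positivity)
  refine ⟨hfin.toFinset, fun z hz G hG => ?_⟩
  obtain ⟨w, hw0, hwz, hT⟩ := hw z hz
  calc ∑ k ∈ G, ‖a k * monom k (fun ν => z ν)‖
      ≤ ∑ k ∈ G, (ε / (C + 1)) * (nn k / kk k * ∏ i ∈ k.support, w i ^ k i) := by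
        refine Finset.sum_le_sum fun k hk => ?_
        have h1 := hG k hk
        simp only [Set.Finite.mem_toFinset, Set.mem_setOf_eq, not_le] at h1
        have hkk := kk_pos k
        have hnn := nn_pos k
        rw [div_lt_iff₀ hnn] at h1
        have h2 : ‖a k * monom k (fun ν => z ν)‖ =
            ‖a k‖ * (∏ ν ∈ k.support, σ ν ^ k ν) * kk k * ((∏ i ∈ k.support, w i ^ k i) / kk k) := by
          simp only [monom, norm_mul, norm_prod, norm_pow, hwz, mul_pow, Finset.prod_mul_distrib]
          field_simp
        have h3 : 0 ≤ (∏ i ∈ k.support, w i ^ k i) / kk k :=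
          div_nonneg (Finset.prod_nonneg fun i _ => pow_nonneg (hw0 i) _) hkk.le
        rw [h2]
        calc _ ≤ ε / (C + 1) * nn k * ((∏ i ∈ k.support, w i ^ k i) / kk k) :=
              mul_le_mul_of_nonneg_right h1.le h3
          _ = _ := by ring
    _ = (ε / (C + 1)) * ∑ k ∈ G, (nn k / kk k * ∏ i ∈ k.support, w i ^ k i) := by
        rw [Finset.mul_sum]
    _ ≤ (ε / (C + 1)) * C := mul_le_mul_of_nonneg_left (hC w hw0 hT G) (by positivity)
    _ ≤ ε := by
        rw [div_mul_eq_mul_div, div_le_iff₀ (by positivity)]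
        nlinarith

lemma part2 (R : ℝ≥0∞) (hR : 0 < R) (h : L1 → ℂ)
    (hol : DifferentiableOn ℂ h {z : L1 | (‖z‖₊ : ℝ≥0∞) < R})
    (a : (ℕ →₀ ℕ) → ℂ)
    (ha : ∀ z : L1, (‖z‖₊ : ℝ≥0∞) < R → {ν : ℕ | z ν ≠ 0}.Finite →
      Summable (fun k => ‖a k * monom k (fun ν => z ν)‖) ∧
      HasSum (fun k => a k * monom k (fun ν => z ν)) (h z)) :
    ∀ K ⊆ {z : L1 | (‖z‖₊ : ℝ≥0∞) < R}, IsCompact K → ∀ ε > (0 : ℝ),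
      ∃ F : Finset (ℕ →₀ ℕ), ∀ z ∈ K,
        ∑' k : {k : ℕ →₀ ℕ // k ∉ F}, ‖a k.1 * monom k.1 (fun ν => z ν)‖ < ε := by
  intro K hKR hK ε hε
  obtain ⟨F, hF⟩ := key_unif R hR h hol a ha K hKR hK (ε / 2) (by positivity)
  refine ⟨F, fun z hz => lt_of_le_of_lt ?_ (half_lt_self hε)⟩
  refine Real.tsum_le_of_sum_le (fun k => norm_nonneg _) fun G => ?_
  have := hF z hz (G.map (Function.Embedding.subtype _)) (by
    intro k hk
    obtain ⟨k', _, rfl⟩ := Finset.mem_map.1 hk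
    exact k'.2)
  rw [Finset.sum_map] at this
  exact this

lemma part1 (R : ℝ≥0∞) (hR : 0 < R) (h : L1 → ℂ)
    (hol : DifferentiableOn ℂ h {z : L1 | (‖z‖₊ : ℝ≥0∞) < R})
    (a : (ℕ →₀ ℕ) → ℂ)
    (ha : ∀ z : L1, (‖z‖₊ : ℝ≥0∞) < R → {ν : ℕ | z ν ≠ 0}.Finite →
      Summable (fun k => ‖a k * monom k (fun ν => z ν)‖) ∧
      HasSum (fun k => a k * monom k (fun ν => z ν)) (h z)) :
    ∀ z : L1, (‖z‖₊ : ℝ≥0∞) < R →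
      Summable (fun k => ‖a k * monom k (fun ν => z ν)‖) ∧
      HasSum (fun k => a k * monom k (fun ν => z ν)) (h z) := by
  classical
  intro z hz
  obtain ⟨F, hF⟩ := key_unif R hR h hol a ha {z} (by simpa using hz) isCompact_singleton 1 one_pos
  have hsum : Summable (fun k => ‖a k * monom k (fun ν => z ν)‖) := by
    refine summable_of_sum_le (c := ∑ k ∈ F, ‖a k * monom k (fun ν => z ν)‖ + 1)
      (fun k => norm_nonneg _) fun G => ?_
    rw [← Finset.sum_filter_add_sum_filter_not G (fun k => k ∈ F)]
    refine add_le_add ?_ (hF z rfl _ fun k hk => (Finset.mem_filter.1 hk).2)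
    exact Finset.sum_le_sum_of_subset_of_nonneg
      (fun k hk => (Finset.mem_filter.1 hk).2) fun k _ _ => norm_nonneg _
  refine ⟨hsum, ?_⟩
  let Z : ℕ → L1 := fun n => ∑ i ∈ Finset.range n, lp.single (E := fun _ : ℕ => ℂ) 1 i (z i)
  have hZc : ∀ n j, Z n j = if j < n then z j else 0 := by
    intro n j
    simp only [Z, lp.coeFn_sum, lp.coeFn_single, Finset.sum_apply, Finset.sum_pi_single,
      Finset.mem_range]
  have hZlim : Filter.Tendsto Z Filter.atTop (nhds z) :=
    (lp.hasSum_single (E := fun _ : ℕ => ℂ) (p := 1) (by simp) z).tendsto_sum_nat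
  have hopen : IsOpen {z : L1 | (‖z‖₊ : ℝ≥0∞) < R} :=
    isOpen_lt (ENNReal.continuous_coe.comp continuous_nnnorm) continuous_const
  have hZin : ∀ n, (‖Z n‖₊ : ℝ≥0∞) < R := by
    intro n
    refine lt_of_le_of_lt ?_ hz
    rw [ENNReal.coe_le_coe, ← NNReal.coe_le_coe, coe_nnnorm, coe_nnnorm]
    simp only [Z]
    rw [norm_sum_single1, l1_norm]
    exact (l1_summable z).sum_le_tsum _ fun i _ => norm_nonneg _
  have hZfin : ∀ n, {ν : ℕ | Z n ν ≠ 0}.Finite := by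
    intro n
    refine (Finset.range n).finite_toSet.subset fun i hi => ?_
    by_contra hin
    apply hi
    rw [hZc, if_neg (by simpa using hin)]
  have hlim1 : Filter.Tendsto (fun n => h (Z n)) Filter.atTop (nhds (h z)) :=
    ((hol.continuousOn.continuousAt (hopen.mem_nhds hz)).tendsto).comp hZlim
  have hlim2 : Filter.Tendsto (fun n => ∑' k, a k * monom k (fun ν => Z n ν)) Filter.atTop
      (nhds (∑' k, a k * monom k (fun ν => z ν))) := by
    refine tendsto_tsum_of_dominated_convergence hsum (fun k => ?_)
      (Filter.Eventually.of_forall fun n k => ?_)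
    · refine tendsto_const_nhds.congr' ?_
      filter_upwards [Filter.eventually_ge_atTop (k.support.sup id + 1)] with n hn
      congr 1
      refine Finset.prod_congr rfl fun i hi => ?_
      have h3 : i ≤ k.support.sup id := Finset.le_sup (f := id) hi
      simp only [hZc]
      rw [if_pos (by omega)]
    · simp only [monom, norm_mul, norm_prod, norm_pow]
      gcongr with i hi
      rw [hZc]
      split_ifs <;> simp
  have heq : (fun n => ∑' k, a k * monom k (fun ν => Z n ν)) = fun n => h (Z n) :=
    funext fun n => (ha (Z n) (hZin n) (hZfin n)).2.tsum_eq
  rw [heq] at hlim2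
  have := tendsto_nhds_unique hlim1 hlim2
  rw [this]
  exact hsum.of_norm.hasSum

/-- Let `0 < R ≤ ∞` and let `h` be holomorphic on `B(R) ⊆ l¹` with monomial
coefficients `(a_k)`. Then for every `z ∈ B(R)` the family `(a_k z^k)` is absolutely summable
with sum `h(z)`, uniformly on compact subsets of `B(R)`; moreover for every real sequence `σ`
with `0 ≤ σ_ν < R`, `σ_ν → 0`, the quantities `|a_k| σ^k k^k/‖k‖^{‖k‖}` tend to `0` along the
cofinite filter (only finitely many `k` satisfy `|a_k| σ^k k^k/‖k‖^{‖k‖} ≥ ε`). -/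
theorem statement8 (R : ℝ≥0∞) (hR : 0 < R) (h : L1 → ℂ)
    (hol : DifferentiableOn ℂ h {z : L1 | (‖z‖₊ : ℝ≥0∞) < R})
    (a : (ℕ →₀ ℕ) → ℂ)
    (ha : ∀ z : L1, (‖z‖₊ : ℝ≥0∞) < R → {ν : ℕ | z ν ≠ 0}.Finite →
      Summable (fun k => ‖a k * monom k (fun ν => z ν)‖) ∧
      HasSum (fun k => a k * monom k (fun ν => z ν)) (h z)) :
    (∀ z : L1, (‖z‖₊ : ℝ≥0∞) < R →
      Summable (fun k => ‖a k * monom k (fun ν => z ν)‖) ∧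
      HasSum (fun k => a k * monom k (fun ν => z ν)) (h z)) ∧
    (∀ K ⊆ {z : L1 | (‖z‖₊ : ℝ≥0∞) < R}, IsCompact K → ∀ ε > (0 : ℝ),
      ∃ F : Finset (ℕ →₀ ℕ), ∀ z ∈ K,
        ∑' k : {k : ℕ →₀ ℕ // k ∉ F}, ‖a k.1 * monom k.1 (fun ν => z ν)‖ < ε) ∧
    ∀ σ : ℕ → ℝ, (∀ ν, 0 ≤ σ ν) → (∀ ν, ENNReal.ofReal (σ ν) < R) →
      Filter.Tendsto σ Filter.atTop (nhds 0) →
      ∀ ε > (0 : ℝ),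
        {k : ℕ →₀ ℕ | ε ≤ ‖a k‖ * (∏ ν ∈ k.support, σ ν ^ k ν) * kk k / nn k}.Finite := by
  exact ⟨part1 R hR h hol a ha, part2 R hR h hol a ha, fun σ hσ hσR hlim ε hε =>
    part3 R hR h hol a ha σ hσ hσR hlim ε hε⟩
end
end
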